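/- arXiv:1612.09482 — 13 statements merged into one kernel-verified Lean document; each statement's English description precedes it below -/
import Mathlib

section
/- Let R be a unital ring with involution. An element a ∈ R has a {1,3}-inverse x (i.e., axa = a and (ax)* = ax) if and only if x*a*a = a. -/
/-- In a unital ring with involution, `x` is a {1,3}-inverse of `a`
(i.e. `a*x*a = a` and `(a*x)* = a*x`) if and only if `x* * a* * a = a`. -/
theorem one_three_inverse_iff {R : Type*} [Ring R] [StarRing R] (a x : R) :
    (a * x * a = a ∧ star (a * x) = a * x) ↔ star x * star a * a = a := by
  rw [← star_mul]
  constructor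
  · rintro ⟨h, hs⟩
    rw [hs, h]
  · intro h
    have hp : star (a * x) * (a * x) = a * x := by rw [← mul_assoc, h]
    have hs : star (a * x) = a * x := (hp ▸ IsSelfAdjoint.star_mul_self (a * x)).star_eq
    exact ⟨by rwa [hs] at h, hs⟩
end

section
/- Let R be a unital ring with involution and a ∈ R. Then a is core invertible if and only if a is group invertible and a has a {1,3}-inverse. In this case, for any {1,3}-inverse a^{(1,3)} of a, the core inverse of a is a^co = a^# a a^{(1,3)}. -/
/-- `x` is the core inverse of `a`. -/
def IsCoreInverse {R : Type*} [Ring R] [StarRing R] (a x : R) : Prop :=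
  a * x * a = a ∧ x * a * x = x ∧ star (a * x) = a * x ∧ a * (x * x) = x ∧ x * (a * a) = a

/-- `z` is the group inverse of `a`. -/
def IsGroupInverse {R : Type*} [Ring R] (a z : R) : Prop :=
  a * z * a = a ∧ z * a * z = z ∧ a * z = z * a

/-- If `x` is the core inverse of `a`, then `x * x * a` is the group inverse of `a`. -/
theorem IsCoreInverse.isGroupInverse {R : Type*} [Ring R] [StarRing R] {a x : R}
    (h : IsCoreInverse a x) : IsGroupInverse a (x * x * a) := by
  obtain ⟨-, hxax, -, haxx, hxaa⟩ := h
  have left : a * (x * x * a) = x * a := by rw [← mul_assoc, haxx]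
  have right : x * x * a * a = x * a := by rw [mul_assoc, mul_assoc, hxaa]
  refine ⟨?_, ?_, left.trans right.symm⟩
  · rw [left, mul_assoc, hxaa]
  · rw [right, ← mul_assoc, ← mul_assoc, hxax]

/-- A group inverse `z` and a {1,3}-inverse `x` of `a` give the core inverse `z * a * x`. -/
theorem IsGroupInverse.isCoreInverse {R : Type*} [Ring R] [StarRing R] {a z x : R}
    (hz : IsGroupInverse a z) (hx : a * x * a = a) (hs : star (a * x) = a * x) :
    IsCoreInverse a (z * a * x) := by
  obtain ⟨haza, hzaz, hcomm⟩ := hz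
  have left : a * (z * a * x) = a * x := by rw [← mul_assoc, ← mul_assoc, haza]
  have right : z * a * x * a = z * a := by rw [mul_assoc, mul_assoc, ← mul_assoc a, hx]
  refine ⟨?_, ?_, ?_, ?_, ?_⟩
  · rw [left, hx]
  · rw [right, ← mul_assoc, ← mul_assoc, hzaz]
  · rw [left, hs]
  · rw [← mul_assoc, left, ← hcomm, ← mul_assoc, ← mul_assoc, hx]
  · rw [← mul_assoc, right, ← hcomm, haza]

/-- `a` is core invertible iff `a` is group invertible and has a
{1,3}-inverse; in that case, for any group inverse `z` and any {1,3}-inverse `x`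
of `a`, the core inverse of `a` is `z * a * x`. -/
theorem core_inverse_iff_group_and_13 {R : Type*} [Ring R] [StarRing R] (a : R) :
    ((∃ x, IsCoreInverse a x) ↔
      (∃ z, IsGroupInverse a z) ∧ (∃ x, a * x * a = a ∧ star (a * x) = a * x)) ∧
    (∀ z x, IsGroupInverse a z → (a * x * a = a ∧ star (a * x) = a * x) →
      IsCoreInverse a (z * a * x)) := by
  refine ⟨⟨?_, ?_⟩, fun z x hz hx => hz.isCoreInverse hx.1 hx.2⟩
  · rintro ⟨x, hx⟩
    exact ⟨⟨_, hx.isGroupInverse⟩, x, hx.1, hx.2.2.1⟩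
  · rintro ⟨⟨z, hz⟩, x, hx, hs⟩
    exact ⟨_, hz.isCoreInverse hx hs⟩
end

section
/- Let R be a unital ring with involution and a ∈ R. The following are equivalent: (1) a is core invertible; (2) there exists a unique projection p (p² = p = p*) such that pa = 0 and u = a + p is invertible; (3) there exists a Hermitian element p (p* = p) such that pa = 0 and u = a + p is invertible. In this case, with u = a + p as in (3), the core inverse of a is a^co = u⁻¹ a u⁻¹ = (u*u)⁻¹ a*. -/
/-- The idempotents `a * x` given by two core inverses of `a` coincide. -/
theorem IsCoreInverse.mul_eq_mul {R : Type*} [Ring R] [StarRing R] {a x y : R}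
    (hx : IsCoreInverse a x) (hy : IsCoreInverse a y) : a * x = a * y := by
  obtain ⟨hx1, -, hx3, -, -⟩ := hx
  obtain ⟨hy1, -, hy3, -, -⟩ := hy
  have h : a * y * (a * x) = a * x := by rw [← mul_assoc, hy1]
  have h' := congrArg star h
  rw [star_mul, hx3, hy3, ← mul_assoc, hx1] at h'
  exact h'.symm

/-- A core inverse `x` of `a` makes `a + (1 - a * x)` invertible. -/
theorem IsCoreInverse.isUnit_add {R : Type*} [Ring R] [StarRing R] {a x : R}
    (hx : IsCoreInverse a x) : IsUnit (a + (1 - a * x)) := by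
  obtain ⟨h1, h2, -, h4, h5⟩ := hx
  refine ⟨⟨a + (1 - a * x), x + (1 - x * a), ?_, ?_⟩, rfl⟩
  · have e1 : a * (x * a) = a := by rw [← mul_assoc, h1]
    have e2 : a * x * x = x := by rw [mul_assoc, h4]
    have e3 : a * x * (x * a) = x * a := by rw [← mul_assoc, e2]
    simp only [add_mul, mul_add, sub_mul, mul_sub, one_mul, mul_one, e1, e2, e3]
    abel
  · have e1 : x * (a * x) = x := by rw [← mul_assoc, h2]
    have e2 : x * a * a = a := by rw [mul_assoc, h5]
    have e3 : x * a * (a * x) = a * x := by rw [← mul_assoc, e2]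
    simp only [add_mul, mul_add, sub_mul, mul_sub, one_mul, mul_one, e1, e2, e3]
    abel

/-- If `p` is Hermitian, `p * a = 0` and `v` is the inverse of `a + p`, then `v * a * v` is the
core inverse of `a`. -/
theorem isCoreInverse_of_hermitian {R : Type*} [Ring R] [StarRing R] {a p v : R}
    (hp : star p = p) (hpa : p * a = 0) (huv : (a + p) * v = 1) (hvu : v * (a + p) = 1) :
    IsCoreInverse a (v * a * v) ∧ a * (v * a * v) = a * v := by
  have hap : star a * p = 0 := by simpa [hp] using congrArg star hpa
  have hsvu : star v * star (a + p) = 1 := by rw [← star_mul, huv, star_one]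
  have hsa : star v * star a * a = a := by
    have : star (a + p) * a = star a * a := by rw [star_add, hp, add_mul, hpa, add_zero]
    rw [mul_assoc, ← this, ← mul_assoc, hsvu, one_mul]
  have he : star (a * v) = a * v := by
    have h : star (a * v) * (a * v) = a * v := by rw [star_mul, ← mul_assoc, hsa]
    have h' := congrArg star h
    rw [star_mul, star_star, h] at h'
    exact h'.symm
  have hava : a * v * a = a := by rw [← he, star_mul, hsa]
  have hpv : p * v = 1 - a * v := by rw [← huv, add_mul, add_sub_cancel_left]
  have hvp : star v * p = 1 - a * v := by
    have h := congrArg star hpv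
    rwa [star_mul, hp, star_sub, star_one, he] at h
  have hq : (1 - a * v) * (1 - a * v) = 1 - a * v := by
    have : a * v * (a * v) = a * v := by rw [← mul_assoc, hava]
    rw [mul_sub, mul_one, sub_mul, one_mul, this, sub_self, sub_zero]
  have hqa : (1 - a * v) * a = 0 := by rw [sub_mul, hava, one_mul, sub_self]
  have hsq : (1 - a * v) * star v * p = 1 - a * v := by rw [mul_assoc, hvp, hq]
  have hqva : (1 - a * v) * (v * a) = 0 := by
    rw [← hsq, mul_assoc, ← mul_assoc p, hpv, hqa, mul_zero]
  have hvaa : v * (a * a) = a := by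
    have : (a + p) * a = a * a := by rw [add_mul, hpa, add_zero]
    rw [← this, ← mul_assoc, hvu, one_mul]
  have hax : a * (v * a * v) = a * v := by rw [← mul_assoc, ← mul_assoc, hava]
  have hva : a * v * (v * a) = v * a := by
    rw [sub_mul, one_mul, sub_eq_zero] at hqva
    exact hqva.symm
  refine ⟨⟨?_, ?_, ?_, ?_, ?_⟩, hax⟩
  · rw [hax, hava]
  · rw [mul_assoc _ a, hax, mul_assoc v, mul_assoc v, ← mul_assoc (a * v), hava]
  · rw [hax, he]
  · rw [← mul_assoc, hax, ← mul_assoc, hva]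
  · rw [← mul_assoc, mul_assoc (v * a), mul_assoc v, ← mul_assoc a, hava, mul_assoc, hvaa]

/-- If `p` is a projection with `p * a = 0` and `v` is a right inverse of `a + p`, then
`p = 1 - a * v`. -/
theorem projection_eq_one_sub_mul {R : Type*} [Ring R] {a p v : R}
    (hpp : p * p = p) (hpa : p * a = 0) (huv : (a + p) * v = 1) : p = 1 - a * v := by
  have h : p * (a + p) = p := by rw [mul_add, hpa, hpp, zero_add]
  have hpv : p * v = p := by
    rw [← h, mul_assoc, huv, mul_one, h]
  rw [← huv, add_mul, hpv, add_sub_cancel_left]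

/-- `a` is core invertible iff there is a unique projection `p` with
`p*a = 0` and `a + p` invertible, iff there is a Hermitian `p` with `p*a = 0` and
`a + p` invertible; in this case, with `u = a + p`, the core inverse of `a` is
`u⁻¹ * a * u⁻¹ = (u* u)⁻¹ * a*`. -/
theorem core_inverse_via_projection {R : Type*} [Ring R] [StarRing R] (a : R) :
    ((∃ x, IsCoreInverse a x) ↔
      (∃! p : R, (p * p = p ∧ star p = p) ∧ p * a = 0 ∧ IsUnit (a + p))) ∧
    ((∃ x, IsCoreInverse a x) ↔
      (∃ p : R, star p = p ∧ p * a = 0 ∧ IsUnit (a + p))) ∧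
    (∀ p : R, star p = p → p * a = 0 → IsUnit (a + p) →
      IsCoreInverse a (Ring.inverse (a + p) * a * Ring.inverse (a + p)) ∧
      Ring.inverse (a + p) * a * Ring.inverse (a + p) =
        Ring.inverse (star (a + p) * (a + p)) * star a) := by
  have hermitian : ∀ p : R, star p = p → p * a = 0 → IsUnit (a + p) →
      IsCoreInverse a (Ring.inverse (a + p) * a * Ring.inverse (a + p)) := fun p hp hpa hu ↦
    (isCoreInverse_of_hermitian hp hpa (Ring.mul_inverse_cancel _ hu)
      (Ring.inverse_mul_cancel _ hu)).1
  have projection : ∀ x, IsCoreInverse a x →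
      ((1 - a * x) * (1 - a * x) = 1 - a * x ∧ star (1 - a * x) = 1 - a * x) ∧
        (1 - a * x) * a = 0 ∧ IsUnit (a + (1 - a * x)) := by
    intro x hx
    have hxx : a * x * (a * x) = a * x := by rw [← mul_assoc, hx.1]
    refine ⟨⟨?_, ?_⟩, ?_, hx.isUnit_add⟩
    · rw [mul_sub, mul_one, sub_mul, one_mul, hxx, sub_self, sub_zero]
    · rw [star_sub, star_one, hx.2.2.1]
    · rw [sub_mul, hx.1, one_mul, sub_self]
  refine ⟨⟨?_, ?_⟩, ⟨?_, ?_⟩, fun p hp hpa hu ↦ ⟨hermitian p hp hpa hu, ?_⟩⟩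
  · rintro ⟨x, hx⟩
    refine ⟨1 - a * x, projection x hx, ?_⟩
    rintro p ⟨⟨hpp, hp⟩, hpa, hu⟩
    have huv := Ring.mul_inverse_cancel _ hu
    obtain ⟨hy, hay⟩ := isCoreInverse_of_hermitian hp hpa huv (Ring.inverse_mul_cancel _ hu)
    rw [hx.mul_eq_mul hy, hay]
    exact projection_eq_one_sub_mul hpp hpa huv
  · rintro ⟨p, ⟨⟨-, hp⟩, hpa, hu⟩, -⟩
    exact ⟨_, hermitian p hp hpa hu⟩
  · rintro ⟨x, hx⟩
    obtain ⟨⟨-, hp⟩, hpa, hu⟩ := projection x hx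
    exact ⟨_, hp, hpa, hu⟩
  · rintro ⟨p, hp, hpa, hu⟩
    exact ⟨_, hermitian p hp hpa hu⟩
  · have huv := Ring.mul_inverse_cancel _ hu
    have hap : star a * p = 0 := by simpa [hp] using congrArg star hpa
    have hsu : star (a + p) * a = star a * (a + p) := by
      rw [star_add, hp, add_mul, hpa, mul_add, hap]
    have key : star (a + p) * (a + p) *
        (Ring.inverse (a + p) * a * Ring.inverse (a + p)) = star a := by
      rw [mul_assoc, mul_assoc (Ring.inverse (a + p)), ← mul_assoc (a + p), huv, one_mul,
        ← mul_assoc, hsu, mul_assoc, huv, mul_one]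
    rw [← key, ← mul_assoc (Ring.inverse (star (a + p) * (a + p))),
      Ring.inverse_mul_cancel _ (hu.star.mul hu), one_mul]
end

section
/- Let R be a unital ring, a ∈ R with a {1,2}-inverse a⁻ (so a a⁻ a = a and a⁻ a a⁻ = a⁻), and e ∈ R such that 1 + a⁻ e is invertible. Put ε = (1 − a a⁻) e (1 + a⁻ e)⁻¹ (1 − a⁻ a) and f = a + e − ε. Then (1 + a⁻ e)⁻¹ a⁻ is a {1,2}-inverse of f; moreover, if τ is a {1}-inverse of a + e (i.e., (a+e)τ(a+e) = a+e), then τ is a {1}-inverse of ε. -/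
/-- if `x` is a {1,2}-inverse of `a` and `1 + x*e` is invertible, then with
`α = (1 + x*e)⁻¹`, `ε = (1 - a*x)*e*α*(1 - x*a)` and `f = a + e - ε`, the element
`α*x` is a {1,2}-inverse of `f`; moreover every {1}-inverse of `a + e` is a
{1}-inverse of `ε`. -/
theorem sum_has_12_inverse {R : Type*} [Ring R] (a x e : R)
    (h1 : a * x * a = a) (h2 : x * a * x = x)
    (hu : IsUnit (1 + x * e))
    (α ε f : R)
    (hα : α = Ring.inverse (1 + x * e))
    (hε : ε = (1 - a * x) * e * α * (1 - x * a))
    (hf : f = a + e - ε) :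
    f * (α * x) * f = f ∧ (α * x) * f * (α * x) = α * x ∧
    (∀ τ : R, (a + e) * τ * (a + e) = a + e → ε * τ * ε = ε) := by
  have hl : α * (1 + x * e) = 1 := by rw [hα]; exact Ring.inverse_mul_cancel _ hu
  have hr : (1 + x * e) * α = 1 := by rw [hα]; exact Ring.mul_inverse_cancel _ hu
  have hqx : (1 - x * a) * x = 0 := by rw [sub_mul, h2, one_mul, sub_self]
  have haq : a * (1 - x * a) = 0 := by rw [mul_sub, ← mul_assoc, h1, mul_one, sub_self]
  have hqα : (1 - x * a) * α = 1 - x * a := by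
    calc (1 - x * a) * α = (1 - x * a) * ((1 + x * e) * α) - (1 - x * a) * x * (e * α) := by
          noncomm_ring
      _ = 1 - x * a := by rw [hr, hqx, zero_mul, mul_one, sub_zero]
  have hyb : α * x * (a + e) = 1 - α * (1 - x * a) := by
    calc α * x * (a + e) = α * (1 + x * e) - α * (1 - x * a) := by noncomm_ring
      _ = 1 - α * (1 - x * a) := by rw [hl]
  have hyby : α * x * (a + e) * (α * x) = α * x := by
    calc α * x * (a + e) * (α * x) = α * x - α * ((1 - x * a) * α * x) := by
          rw [hyb]; noncomm_ring
      _ = α * x := by rw [hqα, hqx, mul_zero, sub_zero]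
  have hxbαq : a * x * (a + e) * α * (1 - x * a) = 0 := by
    calc a * x * (a + e) * α * (1 - x * a)
        = a * ((1 + x * e) * α) * (1 - x * a) - a * (1 - x * a) * (α * (1 - x * a)) := by
          noncomm_ring
      _ = 0 := by rw [hr, haq, mul_one, haq, zero_mul, sub_zero]
  have hpa : (1 - a * x) * a = 0 := by rw [sub_mul, h1, one_mul, sub_self]
  have hεb : ε = (a + e) - (a + e) * (α * x) * (a + e) := by
    calc ε = (a + e) * α * (1 - x * a) - a * x * (a + e) * α * (1 - x * a)
          - (1 - a * x) * a * (α * (1 - x * a)) := by rw [hε]; noncomm_ring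
      _ = (a + e) * (α * (1 - x * a)) := by rw [hxbαq, hpa, zero_mul, sub_zero, sub_zero, mul_assoc]
      _ = (a + e) * (1 - α * x * (a + e)) := by rw [hyb, sub_sub_cancel]
      _ = _ := by noncomm_ring
  have hfb : f = (a + e) * (α * x) * (a + e) := by rw [hf, hεb, sub_sub_cancel]
  generalize α * x = y at *
  generalize a + e = b at *
  have hyby' : ∀ z, y * (b * (y * z)) = y * z := fun z => by
    rw [← mul_assoc, ← mul_assoc, hyby]
  refine ⟨?_, ?_, fun τ hτ => ?_⟩
  · rw [hfb]; simp only [mul_assoc, hyby']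
  · rw [mul_assoc] at hyby
    rw [hfb]; simp only [mul_assoc, hyby', hyby]
  · calc ε * τ * ε = (1 - b * y) * (b * τ * b) * (1 - y * b) := by rw [hεb]; noncomm_ring
      _ = b - b * y * b - b * y * b + b * (y * b * y) * b := by rw [hτ]; noncomm_ring
      _ = ε := by rw [hyby, hεb, sub_add_cancel]
end

section
/- Let R be a unital ring with involution, a ∈ R core invertible with core inverse a^co, and e ∈ R such that 1 + a^co e is invertible. Then 1 + e a^co is invertible, and with α = (1 + a^co e)⁻¹, β = (1 + e a^co)⁻¹, ε = (1 − a a^co) e α (1 − a^co a), f = a + e − ε, and f₀ = α a^co, one has: f f₀ f = f, f₀ f f₀ = f₀, 1 − f₀ f = α(1 − a^co a), and 1 − f f₀ = (1 − a a^co) β. -/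
/-- If `1 + x * y` is a unit of a ring, then so is `1 + y * x`. -/
theorem isUnit_one_add_mul_swap {R : Type*} [Ring R] {x y : R} (h : IsUnit (1 + x * y)) :
    IsUnit (1 + y * x) := by
  obtain ⟨u, hu⟩ := h
  have hr : (1 + x * y) * (↑u⁻¹ : R) = 1 := by rw [← hu, Units.mul_inv]
  have hl : (↑u⁻¹ : R) * (1 + x * y) = 1 := by rw [← hu, Units.inv_mul]
  refine ⟨⟨1 + y * x, 1 - y * ↑u⁻¹ * x, ?_, ?_⟩, rfl⟩
  · calc (1 + y * x) * (1 - y * ↑u⁻¹ * x)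
        = 1 + y * x - y * ((1 + x * y) * ↑u⁻¹) * x := by noncomm_ring
      _ = 1 := by rw [hr, mul_one, add_sub_cancel_right]
  · calc (1 - y * ↑u⁻¹ * x) * (1 + y * x)
        = 1 + y * x - y * (↑u⁻¹ * (1 + x * y)) * x := by noncomm_ring
      _ = 1 := by rw [hl, mul_one, add_sub_cancel_right]

/-- A left inverse `b` of `1 + x * y` and a right inverse `c` of `1 + y * x` are intertwined
by `x`. -/
theorem inverse_mul_eq_mul_inverse {R : Type*} [Ring R] {x y b c : R}
    (hb : b * (1 + x * y) = 1) (hc : (1 + y * x) * c = 1) : b * x = x * c := by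
  calc b * x = b * x * ((1 + y * x) * c) := by rw [hc, mul_one]
    _ = b * (1 + x * y) * (x * c) := by noncomm_ring
    _ = x * c := by rw [hb, one_mul]

/-- basic identities for `f = a + e - ε` and `f₀ = α * a^co`. -/
theorem sum_core_basic_identities {R : Type*} [Ring R] [StarRing R] (a aco e : R)
    (ha : IsCoreInverse a aco)
    (hu : IsUnit (1 + aco * e))
    (α β ε f f₀ : R)
    (hα : α = Ring.inverse (1 + aco * e))
    (hβ : β = Ring.inverse (1 + e * aco))
    (hε : ε = (1 - a * aco) * e * α * (1 - aco * a))
    (hf : f = a + e - ε)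
    (hf₀ : f₀ = α * aco) :
    IsUnit (1 + e * aco) ∧
    f * f₀ * f = f ∧ f₀ * f * f₀ = f₀ ∧
    1 - f₀ * f = α * (1 - aco * a) ∧
    1 - f * f₀ = (1 - a * aco) * β := by
  obtain ⟨haxa, hxax, -, -, -⟩ := ha
  have hαr : (1 + aco * e) * α = 1 := by rw [hα, Ring.mul_inverse_cancel _ hu]
  have hαl : α * (1 + aco * e) = 1 := by rw [hα, Ring.inverse_mul_cancel _ hu]
  have hv : IsUnit (1 + e * aco) := isUnit_one_add_mul_swap hu
  have hβr : (1 + e * aco) * β = 1 := by rw [hβ, Ring.mul_inverse_cancel _ hv]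
  have hswap : α * aco = aco * β := inverse_mul_eq_mul_inverse hαl hβr
  have hqx : (1 - aco * a) * aco = 0 := by rw [sub_mul, one_mul, hxax, sub_self]
  have hxp : aco * (1 - a * aco) = 0 := by
    rw [mul_sub, mul_one, ← mul_assoc, hxax, sub_self]
  have haq : a * (1 - aco * a) = 0 := by
    rw [mul_sub, mul_one, ← mul_assoc, haxa, sub_self]
  have hqf₀ : (1 - aco * a) * f₀ = 0 := by
    rw [hf₀, hswap, ← mul_assoc, hqx, zero_mul]
  have hxε : aco * ε = 0 := by
    rw [hε]
    simp only [← mul_assoc, hxp, zero_mul]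
  have hεf₀ : ε * f₀ = 0 := by
    rw [hε, mul_assoc, hqf₀, mul_zero]
  have hqα : (1 - aco * a) * α = 1 - aco * a := by
    calc (1 - aco * a) * α
        = (1 - aco * a) * ((1 + aco * e) * α) - (1 - aco * a) * aco * (e * α) := by
          noncomm_ring
      _ = 1 - aco * a := by rw [hαr, hqx, mul_one, zero_mul, sub_zero]
  have hqq : (1 - aco * a) * (1 - aco * a) = 1 - aco * a := by
    rw [mul_sub, mul_one, ← mul_assoc, hqx, zero_mul, sub_zero]
  have hleft : 1 - f₀ * f = α * (1 - aco * a) := by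
    calc 1 - f₀ * f
        = 1 - α * (1 + aco * e) + α * (1 - aco * a) + α * (aco * ε) := by
          rw [hf₀, hf]; noncomm_ring
      _ = α * (1 - aco * a) := by rw [hαl, hxε, sub_self, zero_add, mul_zero, add_zero]
  have hright : 1 - f * f₀ = (1 - a * aco) * β := by
    calc 1 - f * f₀ = 1 - (a + e) * f₀ + ε * f₀ := by rw [hf]; noncomm_ring
      _ = 1 - (1 + e * aco) * β + (1 - a * aco) * β := by
          rw [hεf₀, hf₀, hswap]; noncomm_ring
      _ = (1 - a * aco) * β := by rw [hβr, sub_self, zero_add]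
  have hεα : ε * (α * (1 - aco * a)) = (1 - a * aco) * e * α * (1 - aco * a) := by
    rw [hε, mul_assoc _ (1 - aco * a), ← mul_assoc (1 - aco * a), hqα, hqq]
  have hfα : f * (α * (1 - aco * a)) = 0 := by
    calc f * (α * (1 - aco * a))
        = (a + e) * (α * (1 - aco * a)) - ε * (α * (1 - aco * a)) := by rw [hf, sub_mul]
      _ = a * ((1 + aco * e) * α) * (1 - aco * a) := by rw [hεα]; noncomm_ring
      _ = 0 := by rw [hαr, mul_one, haq]
  refine ⟨hv, ?_, ?_, hleft, hright⟩
  · rw [← hleft, mul_sub, mul_one, ← mul_assoc] at hfα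
    exact (sub_eq_zero.mp hfα).symm
  · have h : (1 - f₀ * f) * f₀ = 0 := by rw [hleft, mul_assoc, hqf₀, mul_zero]
    rw [sub_mul, one_mul] at h
    exact (sub_eq_zero.mp h).symm
end

section
/- Let R be a unital ring with involution, a ∈ R core invertible with core inverse a^co, and e ∈ R such that 1 + a^co e is invertible. With α = (1 + a^co e)⁻¹, β = (1 + e a^co)⁻¹, ε = (1 − a a^co) e α (1 − a^co a), f = a + e − ε, γ = α(1 − a^co a) β⁻¹ a a^co β, σ = α a^co a α⁻¹ (1 − a a^co) β, δ = β* (a^co)* e* (1 − a a^co) β, and f₀ = α a^co, the following identities hold: γ = (1 − f₀f) f f₀, σ = f₀ f (1 − f f₀), δ = (f f₀)* (1 − f f₀), f γ = 0, σ f = 0, and δ f = 0. -/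
/-- identities for `γ`, `σ`, `δ` in terms of `f` and `f₀ = α * a^co`. -/
theorem gamma_sigma_delta_identities {R : Type*} [Ring R] [StarRing R] (a aco e : R)
    (ha : IsCoreInverse a aco)
    (hu : IsUnit (1 + aco * e))
    (α β ε f γ σ δ f₀ : R)
    (hα : α = Ring.inverse (1 + aco * e))
    (hβ : β = Ring.inverse (1 + e * aco))
    (hε : ε = (1 - a * aco) * e * α * (1 - aco * a))
    (hf : f = a + e - ε)
    (hγ : γ = α * (1 - aco * a) * (1 + e * aco) * (a * aco) * β)
    (hσ : σ = α * (aco * a) * (1 + aco * e) * (1 - a * aco) * β)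
    (hδ : δ = star β * star aco * star e * (1 - a * aco) * β)
    (hf₀ : f₀ = α * aco) :
    γ = (1 - f₀ * f) * (f * f₀) ∧
    σ = f₀ * f * (1 - f * f₀) ∧
    δ = star (f * f₀) * (1 - f * f₀) ∧
    f * γ = 0 ∧ σ * f = 0 ∧ δ * f = 0 := by
  obtain ⟨haxa, hxax, hstar, -, -⟩ := ha
  have hv : IsUnit (1 + e * aco) := isUnit_one_add_mul_swap hu
  have hα₁ : α * (1 + aco * e) = 1 := hα ▸ Ring.inverse_mul_cancel _ hu
  have hα₂ : (1 + aco * e) * α = 1 := hα ▸ Ring.mul_inverse_cancel _ hu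
  have hβ₁ : β * (1 + e * aco) = 1 := hβ ▸ Ring.inverse_mul_cancel _ hv
  have hβ₂ : (1 + e * aco) * β = 1 := hβ ▸ Ring.mul_inverse_cancel _ hv
  clear hα hβ
  have hαx : α * aco = aco * β := by
    calc α * aco = α * aco * ((1 + e * aco) * β) := by rw [hβ₂, mul_one]
      _ = α * (1 + aco * e) * aco * β := by noncomm_ring
      _ = aco * β := by rw [hα₁, one_mul]
  have heα : e * α = β * e := by
    calc e * α = β * (1 + e * aco) * e * α := by rw [hβ₁, one_mul]
      _ = β * e * ((1 + aco * e) * α) := by noncomm_ring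
      _ = β * e := by rw [hα₂, mul_one]
  have hxp : aco * (1 - a * aco) = 0 := by rw [mul_sub, ← mul_assoc, hxax, mul_one, sub_self]
  have hqx : (1 - aco * a) * aco = 0 := by rw [sub_mul, hxax, one_mul, sub_self]
  have hpa : (1 - a * aco) * a = 0 := by rw [sub_mul, haxa, one_mul, sub_self]
  have hpp : (1 - a * aco) * (1 - a * aco) = 1 - a * aco := by
    rw [mul_sub, mul_one, ← mul_assoc, hpa, zero_mul, sub_zero]
  have hβp : β * (1 - a * aco) = 1 - a * aco := by
    calc β * (1 - a * aco) = β * (1 - a * aco + e * (aco * (1 - a * aco))) := by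
          rw [hxp, mul_zero, add_zero]
      _ = β * (1 + e * aco) * (1 - a * aco) := by noncomm_ring
      _ = 1 - a * aco := by rw [hβ₁, one_mul]
  have hff₀ : f * f₀ = (a * aco + e * aco) * β := by
    calc f * f₀ = (a + e) * (α * aco)
          - (1 - a * aco) * e * α * (1 - aco * a) * (α * aco) := by rw [hf, hε, hf₀, sub_mul]
      _ = (a * aco + e * aco) * β
          - (1 - a * aco) * e * α * ((1 - aco * a) * aco) * β := by rw [hαx]; noncomm_ring
      _ = _ := by rw [hqx]; simp
  have hf₀f : f₀ * f = α * (aco * a + aco * e) := by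
    calc f₀ * f = α * (aco * a + aco * e)
          - α * (aco * (1 - a * aco)) * e * α * (1 - aco * a) := by
          rw [hf, hε, hf₀]; noncomm_ring
      _ = _ := by rw [hxp]; simp
  have hff₀' : 1 - f * f₀ = (1 - a * aco) * β := by
    calc 1 - f * f₀ = (1 + e * aco) * β - (a * aco + e * aco) * β := by rw [hff₀, hβ₂]
      _ = _ := by noncomm_ring
  have hf₀f' : 1 - f₀ * f = α * (1 - aco * a) := by
    calc 1 - f₀ * f = α * (1 + aco * e) - α * (aco * a + aco * e) := by rw [hf₀f, hα₁]
      _ = _ := by noncomm_ring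
  have hpβf : (1 - a * aco) * β * f = 0 := by
    have hβae : β * (a + e) = a + e * α * (1 - aco * a) := by
      calc β * (a + e) = β * (1 + e * aco) * a + β * e * (1 - aco * a) := by noncomm_ring
        _ = _ := by rw [hβ₁, one_mul, heα]
    calc (1 - a * aco) * β * f = (1 - a * aco) * (β * (a + e))
          - (1 - a * aco) * (β * (1 - a * aco)) * e * α * (1 - aco * a) := by
          rw [hf, hε]; noncomm_ring
      _ = (1 - a * aco) * a := by rw [hβae, hβp, hpp]; noncomm_ring
      _ = 0 := hpa
  have hfαq : f * (α * (1 - aco * a)) = 0 := by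
    rw [← hf₀f', mul_sub, mul_one, ← mul_assoc, ← one_sub_mul, hff₀', hpβf]
  refine ⟨?_, ?_, ?_, ?_, ?_, ?_⟩
  · calc γ = α * (1 - aco * a) * (a * aco + e * (aco * a * aco)) * β := by
          rw [hγ]; noncomm_ring
      _ = _ := by rw [hxax, hf₀f', hff₀]; simp only [mul_assoc]
  · calc σ = α * (aco * a + aco * a * aco * e) * ((1 - a * aco) * β) := by
          rw [hσ]; noncomm_ring
      _ = _ := by rw [hxax, hff₀', hf₀f]
  · have hpp' : a * aco * (1 - a * aco) = 0 := by rw [mul_assoc, hxp, mul_zero]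
    rw [hff₀', hff₀, star_mul, star_add, hstar, star_mul, hδ]
    calc _ = star β * (a * aco * (1 - a * aco)) * β
          + star β * star aco * star e * (1 - a * aco) * β := by
          rw [hpp']; simp
      _ = _ := by noncomm_ring
  · calc f * γ = f * (α * (1 - aco * a)) * ((1 + e * aco) * (a * aco) * β) := by
          rw [hγ]; simp only [mul_assoc]
      _ = 0 := by rw [hfαq, zero_mul]
  · rw [hσ, mul_assoc _ _ β, mul_assoc _ _ f, hpβf, mul_zero]
  · rw [hδ, mul_assoc _ _ β, mul_assoc _ _ f, hpβf, mul_zero]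
end

section
/- Let R be a unital ring with involution, a ∈ R core invertible with core inverse a^co, and e ∈ R such that 1 + a^co e is invertible. With α = (1 + a^co e)⁻¹, β = (1 + e a^co)⁻¹, ε = (1 − a a^co) e α (1 − a^co a), f = a + e − ε, γ = α(1 − a^co a) β⁻¹ a a^co β, σ = α a^co a α⁻¹ (1 − a a^co) β, and δ = β* (a^co)* e* (1 − a a^co) β, the element f is core invertible if and only if 1 − γ, 1 − σ, and 1 − δ are all invertible in R. -/
theorem mul_mul_eq_of_mul_eq {M : Type*} [Semigroup M] {a b c : M} (h : a * b = c) (d : M) :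
    a * (b * d) = c * d := by
  rw [← mul_assoc, h]

section Idempotents

variable {R : Type*} [Ring R] {P Q E p : R}

/-- If `p` has the range of the idempotent `Q` and the kernel of the idempotent `P`, while `E` has
the range of `P` and the kernel of `Q`, then `1 - (1 - Q) * P` is invertible. -/
theorem isUnit_one_sub_compl_mul (hPp : P * p = P) (hpP : p * P = p)
    (hQp : Q * p = p) (hpQ : p * Q = Q) (hEP : E * P = P) (hPE : P * E = E) (hEQ : E * Q = E)
    (hQE : Q * E = Q) : IsUnit (1 - (1 - Q) * P) := by
  refine isUnit_iff_exists.2 ⟨1 - p + E * p, ?_, ?_⟩ <;>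
  simp only [mul_sub, sub_mul, mul_add, mul_one, one_mul, add_mul, mul_assoc, hPp, hpP, hQp,
    hEP, mul_mul_eq_of_mul_eq hPE, mul_mul_eq_of_mul_eq hQE, mul_mul_eq_of_mul_eq hpQ,
    mul_mul_eq_of_mul_eq hEQ] <;> abel

/-- If `p` has the range of the idempotent `Q` and the kernel of the idempotent `P`, while `E` has
the range of `P` and the kernel of `Q`, then `1 - Q * (1 - P)` is invertible. -/
theorem isUnit_one_sub_mul_compl (hPp : P * p = P) (hpP : p * P = p)
    (hQp : Q * p = p) (hpQ : p * Q = Q) (hEP : E * P = P) (hPE : P * E = E) (hEQ : E * Q = E)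
    (hQE : Q * E = Q) : IsUnit (1 - Q * (1 - P)) := by
  refine isUnit_iff_exists.2 ⟨1 - p + p * E, ?_, ?_⟩ <;>
  simp only [mul_sub, sub_mul, mul_add, mul_one, one_mul, add_mul, mul_assoc, hPp, hpP, hQp, hpQ,
    hEP, hPE, hEQ, hQE, mul_mul_eq_of_mul_eq hPp, mul_mul_eq_of_mul_eq hQp,
    mul_mul_eq_of_mul_eq hpQ, mul_mul_eq_of_mul_eq hEQ] <;> abel

/-- If the idempotent `P` has the same kernel as a projection `p`, then its range is the range of a
projection if and only if `1 - star P * (1 - P)` is invertible. -/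
theorem isUnit_one_sub_star_mul_compl_iff [StarRing R] (hp : star p = p) (hPp : P * p = P)
    (hpP : p * P = p) :
    IsUnit (1 - star P * (1 - P)) ↔ ∃ G, star G = G ∧ P * G = G ∧ G * P = P := by
  have hPP : P * P = P := by
    calc P * P = P * p * P := by rw [hPp]
      _ = P := by rw [mul_assoc, hpP, hPp]
  have hSS : star P * star P = star P := by rw [← star_mul, hPP]
  have hpS : p * star P = star P := by simpa [hp] using congrArg star hPp
  have hSp : star P * p = p := by simpa [hp] using congrArg star hpP
  have hfac : 1 - star P * (1 - P) = (P + star P - 1) * (P + p - 1) := by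
    simp only [mul_sub, sub_mul, mul_add, mul_one, one_mul, add_mul, hPP, hPp, hSp]
    abel
  have hinv : IsUnit (P + p - 1) := by
    have hpp : p * p = p := by
      calc p * p = p * (P * p) := by rw [← mul_assoc, hpP]
        _ = p := by rw [hPp, hpP]
    refine isUnit_iff_exists.2 ⟨P + p - 1, ?_, ?_⟩ <;>
    · simp only [mul_sub, sub_mul, mul_add, mul_one, one_mul, add_mul, hPP, hPp, hpP, hpp]
      abel
  rw [hfac, hinv.mul_right_iff]
  constructor
  · rintro ⟨D, hD⟩
    have hDS : star P * (D : R) = D * P := by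
      simp only [hD, mul_sub, sub_mul, mul_add, mul_one, one_mul, add_mul, hSS, hPP]
      abel
    have hDD : star (D : R) = D := by simp [hD, add_comm]
    have hG : P * (↑D⁻¹ : R) = ↑D⁻¹ * star P := by
      rw [Units.eq_inv_mul_iff_mul_eq, ← mul_assoc, ← hDS, mul_assoc, Units.mul_inv, mul_one]
    have hDi : star (↑D⁻¹ : R) = ↑D⁻¹ := by
      rw [← Units.mul_left_inj D, Units.inv_mul]
      simpa only [star_mul, hDD, star_one] using congrArg star D.mul_inv
    refine ⟨P * ↑D⁻¹, ?_, ?_, ?_⟩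
    · rw [star_mul, hDi, hG]
    · rw [← mul_assoc, hPP]
    · rw [hG, mul_assoc, Units.inv_mul_eq_iff_eq_mul, ← hDS, hD]
      simp only [mul_sub, mul_add, mul_one, hSS]
      abel
  · rintro ⟨G, hG, hPG, hGP⟩
    have hGS : G * star P = G := by simpa [hG] using congrArg star hPG
    have hSG : star P * G = star P := by simpa [hG] using congrArg star hGP
    refine isUnit_iff_exists.2 ⟨p + G - 1, ?_, ?_⟩ <;>
    · simp only [mul_sub, sub_mul, mul_add, mul_one, one_mul, add_mul, hPp, hpP, hpS, hSp, hPG,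
        hGP, hGS, hSG]
      abel

end Idempotents

/-- An element `f = f * f * s = t * f * f` whose range is the range of a projection `G` is core
invertible. -/
theorem isCoreInverse_of_group_inverse {R : Type*} [Ring R] [StarRing R] {f y s t G : R}
    (hs : f * f * s = f) (ht : t * (f * f) = f) (hG : star G = G) (hPG : f * y * G = G)
    (hGf : G * f = f) : IsCoreInverse f (t * f * s * G) := by
  have hts : t * f = f * s := by
    calc t * f = t * (f * f * s) := by rw [hs]
      _ = t * (f * f) * s := by noncomm_ring
      _ = f * s := by rw [ht]
  have hfG : f * s * G = G := by
    calc f * s * G = t * f * (f * y * G) := by rw [hts, hPG]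
      _ = t * (f * f) * y * G := by noncomm_ring
      _ = G := by rw [ht, hPG]
  have hfx : f * (t * f * s * G) = G := by
    calc f * (t * f * s * G) = f * (t * f) * s * G := by noncomm_ring
      _ = f * f * s * s * G := by rw [hts]; noncomm_ring
      _ = G := by rw [hs, hfG]
  have hxG : t * f * s * G * G = t * f * s * G := by
    have hGG : G * G = G := by
      calc G * G = G * f * (t * f * s * G) := by rw [mul_assoc, hfx]
        _ = G := by rw [hGf, hfx]
    rw [mul_assoc, hGG]
  refine ⟨by rw [hfx, hGf], by rw [mul_assoc _ f, hfx, hxG], by rw [hfx, hG], ?_, ?_⟩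
  · calc f * (t * f * s * G * (t * f * s * G)) = f * (t * f * s * G) * (t * f * s * G) := by
          noncomm_ring
      _ = G * f * s * s * G := by rw [hfx, hts]; noncomm_ring
      _ = t * f * s * G := by rw [hGf, hts]
  · calc t * f * s * G * (f * f) = t * f * s * (G * f) * f := by noncomm_ring
      _ = t * (f * s) * f * f := by rw [hGf]; noncomm_ring
      _ = t * (t * (f * f)) * f := by rw [← hts]; noncomm_ring
      _ = f := by rw [ht, mul_assoc, ht]

/-- Core invertibility of `f` in terms of a reflexive generalized inverse `y` that is itself core
invertible, `p` being the projection onto its range. -/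
theorem exists_isCoreInverse_iff_of_reflexive_inverse {R : Type*} [Ring R] [StarRing R]
    {f y p : R} (hfyf : f * y * f = f) (hp : star p = p) (hPp : f * y * p = f * y)
    (hpP : p * (f * y) = p) (hQp : y * f * p = p) (hpQ : p * (y * f) = y * f) :
    (∃ x, IsCoreInverse f x) ↔ IsUnit (1 - (1 - y * f) * (f * y)) ∧
      IsUnit (1 - y * f * (1 - f * y)) ∧ IsUnit (1 - star (f * y) * (1 - f * y)) := by
  rw [isUnit_one_sub_star_mul_compl_iff hp hPp hpP]
  constructor
  · rintro ⟨x, hfxf, hxfx, hstar, hfxx, hxff⟩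
    have hE : f * (x * x * f) = x * f := by rw [← mul_assoc, hfxx]
    have hEP : x * f * (f * y) = f * y := by
      rw [← mul_assoc, mul_assoc x, hxff]
    have hPE : f * y * (x * f) = x * f := by
      rw [← hE, ← mul_assoc, hfyf]
    have hEQ : x * f * (y * f) = x * f := by
      rw [mul_assoc, ← mul_assoc f, hfyf]
    have hQE : y * f * (x * f) = y * f := by
      rw [mul_assoc, ← mul_assoc f, hfxf]
    refine ⟨isUnit_one_sub_compl_mul hPp hpP hQp hpQ hEP hPE hEQ hQE,
      isUnit_one_sub_mul_compl hPp hpP hQp hpQ hEP hPE hEQ hQE, f * x, hstar, ?_, ?_⟩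
    · rw [← mul_assoc, hfyf]
    · rw [← mul_assoc, hfxf]
  · rintro ⟨⟨W, hW⟩, ⟨V, hV⟩, G, hG, hPG, hGP⟩
    have hPP : f * y * (f * y) = f * y := by rw [← mul_assoc, hfyf]
    have hQQ : y * f * (y * f) = y * f := by rw [mul_assoc, ← mul_assoc f, hfyf]
    have hWP : (W : R) * (f * y) = y * f * (f * y) := by
      calc (W : R) * (f * y) = f * y - (1 - y * f) * (f * y * (f * y)) := by
            rw [hW]; noncomm_ring
        _ = y * f * (f * y) := by rw [hPP]; noncomm_ring
    have hVQ : y * f * (V : R) = y * f * (f * y) := by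
      simp only [hV, mul_sub, mul_one, ← mul_assoc _ (y * f), hQQ]
      abel
    have ht : ↑W⁻¹ * y * (f * f) = f := by
      calc ↑W⁻¹ * y * (f * f) = ↑W⁻¹ * (y * f * (f * y)) * f := by
            nth_rw 2 [← hfyf]; noncomm_ring
        _ = f := by rw [← hWP, Units.inv_mul_cancel_left, hfyf]
    have hs : f * f * (y * ↑V⁻¹) = f := by
      calc f * f * (y * ↑V⁻¹) = f * (y * f * (f * y)) * ↑V⁻¹ := by
            nth_rw 1 [← hfyf]; noncomm_ring
        _ = f := by rw [← hVQ, mul_assoc, Units.mul_inv_cancel_right, ← mul_assoc, hfyf]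
    exact ⟨_, isCoreInverse_of_group_inverse hs ht hG hPG (by
      rw [← hfyf, ← mul_assoc, hGP])⟩

/-- `f` is core invertible iff `1 - γ`, `1 - σ` and `1 - δ` are invertible. -/
theorem sum_core_invertible_iff {R : Type*} [Ring R] [StarRing R] (a aco e : R)
    (ha : IsCoreInverse a aco)
    (hu : IsUnit (1 + aco * e))
    (α β ε f γ σ δ : R)
    (hα : α = Ring.inverse (1 + aco * e))
    (hβ : β = Ring.inverse (1 + e * aco))
    (hε : ε = (1 - a * aco) * e * α * (1 - aco * a))
    (hf : f = a + e - ε)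
    (hγ : γ = α * (1 - aco * a) * (1 + e * aco) * (a * aco) * β)
    (hσ : σ = α * (aco * a) * (1 + aco * e) * (1 - a * aco) * β)
    (hδ : δ = star β * star aco * star e * (1 - a * aco) * β) :
    (∃ x, IsCoreInverse f x) ↔ (IsUnit (1 - γ) ∧ IsUnit (1 - σ) ∧ IsUnit (1 - δ)) := by
  obtain ⟨haxa, hxax, hstar, haxx, hxaa⟩ := ha
  have hα₁ : (1 + aco * e) * α = 1 := hα ▸ Ring.mul_inverse_cancel _ hu
  have hα₂ : α * (1 + aco * e) = 1 := hα ▸ Ring.inverse_mul_cancel _ hu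
  have hv : IsUnit (1 + e * aco) := by
    refine isUnit_iff_exists.2 ⟨1 - e * α * aco, ?_, ?_⟩
    · calc (1 + e * aco) * (1 - e * α * aco)
          = 1 + e * aco - e * ((1 + aco * e) * α) * aco := by noncomm_ring
        _ = 1 := by rw [hα₁]; noncomm_ring
    · calc (1 - e * α * aco) * (1 + e * aco)
          = 1 + e * aco - e * (α * (1 + aco * e)) * aco := by noncomm_ring
        _ = 1 := by rw [hα₂]; noncomm_ring
  have hβ₁ : (1 + e * aco) * β = 1 := hβ ▸ Ring.mul_inverse_cancel _ hv
  have hβ₂ : β * (1 + e * aco) = 1 := hβ ▸ Ring.inverse_mul_cancel _ hv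
  clear hα hβ hu hv
  have hy : α * aco = aco * β := by
    calc α * aco = α * aco * ((1 + e * aco) * β) := by rw [hβ₁, mul_one]
      _ = α * (1 + aco * e) * aco * β := by noncomm_ring
      _ = aco * β := by rw [hα₂, one_mul]
  have heα : e * α = β * e := by
    calc e * α = β * (1 + e * aco) * e * α := by rw [hβ₂, one_mul]
      _ = β * e * ((1 + aco * e) * α) := by noncomm_ring
      _ = β * e := by rw [hα₁, mul_one]
  have hqx : (1 - aco * a) * aco = 0 := by rw [sub_mul, one_mul, hxax, sub_self]
  have hxp : aco * (1 - a * aco) = 0 := by rw [mul_sub, mul_one, ← mul_assoc, hxax, sub_self]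
  have hpa : (1 - a * aco) * a = 0 := by rw [sub_mul, one_mul, haxa, sub_self]
  have hpx : a * aco * aco = aco := by rw [mul_assoc, haxx]
  have hqp : aco * a * (a * aco) = a * aco := by
    rw [← mul_assoc, mul_assoc aco, hxaa]
  have hqα : (1 - aco * a) * α = 1 - aco * a := by
    calc (1 - aco * a) * α = (1 - aco * a) * ((1 + aco * e) * α)
          - (1 - aco * a) * aco * e * α := by noncomm_ring
      _ = 1 - aco * a := by rw [hα₁, hqx]; noncomm_ring
  have hβp : β * (1 - a * aco) = 1 - a * aco := by
    calc β * (1 - a * aco) = β * (1 + e * aco) * (1 - a * aco)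
          - β * e * (aco * (1 - a * aco)) := by noncomm_ring
      _ = 1 - a * aco := by rw [hβ₂, hxp]; noncomm_ring
  have hfy : f * (α * aco) = 1 - (1 - a * aco) * β := by
    calc f * (α * aco) = (a + e) * (α * aco)
          - (1 - a * aco) * e * α * ((1 - aco * a) * α * aco) := by
            rw [hf, hε]; noncomm_ring
      _ = (1 + e * aco) * β - (1 - a * aco) * β := by
            rw [hqα, hqx, hy]; noncomm_ring
      _ = _ := by rw [hβ₁]
  have hyf : α * aco * f = 1 - α * (1 - aco * a) := by
    calc α * aco * f = α * aco * (a + e)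
          - α * (aco * (1 - a * aco)) * e * α * (1 - aco * a) := by
            rw [hf, hε]; noncomm_ring
      _ = α * (1 + aco * e) - α * (1 - aco * a) := by
            rw [hxp]; noncomm_ring
      _ = _ := by rw [hα₂]
  have hpf : (1 - a * aco) * β * f = 0 := by
    calc (1 - a * aco) * β * f = (1 - a * aco) * β * a + (1 - a * aco) * (β * e)
          - (1 - a * aco) * (β * (1 - a * aco)) * e * α * (1 - aco * a) := by
            rw [hf, hε]; noncomm_ring
      _ = (1 - a * aco) * β * a + (1 - a * aco) * (β * e)
          - (1 - a * aco) * (1 - a * aco) * (e * α) * (1 - aco * a) := by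
            rw [hβp]; noncomm_ring
      _ = (1 - a * aco) * β * a + (1 - a * aco) * (β * e)
          - ((1 - a * aco) - (1 - a * aco) * a * aco) * (e * α) * (1 - aco * a) := by
            noncomm_ring
      _ = (1 - a * aco) * (β * (1 + e * aco)) * a := by
            rw [hpa, heα]; noncomm_ring
      _ = 0 := by rw [hβ₂, mul_one, hpa]
  have hfyf : f * (α * aco) * f = f := by rw [hfy, sub_mul, hpf, one_mul, sub_zero]
  have hPp : f * (α * aco) * (a * aco) = f * (α * aco) := by
    calc f * (α * aco) * (a * aco) = f * α * (aco * a * aco) := by noncomm_ring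
      _ = f * (α * aco) := by rw [hxax, mul_assoc]
  have hpP : a * aco * (f * (α * aco)) = a * aco := by
    calc a * aco * (f * (α * aco)) = a * aco - a * (aco * (1 - a * aco)) * β := by
          rw [hfy]; noncomm_ring
      _ = a * aco := by rw [hxp]; noncomm_ring
  have hQp : α * aco * f * (a * aco) = a * aco := by
    calc α * aco * f * (a * aco) = a * aco - α * (a * aco - aco * a * (a * aco)) := by
          rw [hyf]; noncomm_ring
      _ = a * aco := by rw [hqp]; noncomm_ring
  have hpQ : a * aco * (α * aco * f) = α * aco * f := by
    rw [← mul_assoc, hy, ← mul_assoc, hpx]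
  have hγ' : γ = (1 - α * aco * f) * (f * (α * aco)) := by
    have hP : f * (α * aco) = (1 + e * aco) * (a * aco) * β := by
      calc f * (α * aco) = (1 + e * aco) * β - (1 - a * aco) * β := by rw [hfy, hβ₁]
        _ = (a * aco + e * (aco * a * aco)) * β := by rw [hxax]; noncomm_ring
        _ = _ := by noncomm_ring
    rw [hP, hγ, hyf]; noncomm_ring
  have hσ' : σ = α * aco * f * (1 - f * (α * aco)) := by
    have hQ : α * aco * f = α * (aco * a) * (1 + aco * e) := by
      calc α * aco * f = α * (1 + aco * e) - α * (1 - aco * a) := by rw [hyf, hα₂]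
        _ = α * (aco * a + aco * a * aco * e) := by rw [hxax]; noncomm_ring
        _ = _ := by noncomm_ring
    rw [hQ, hσ, hfy]; noncomm_ring
  have hδ' : δ = star (f * (α * aco)) * (1 - f * (α * aco)) := by
    have hP : f * (α * aco) = a * aco * β + e * aco * β := by
      calc f * (α * aco) = (1 + e * aco) * β - (1 - a * aco) * β := by rw [hfy, hβ₁]
        _ = _ := by noncomm_ring
    have h0 : a * aco * (1 - a * aco) = 0 := by rw [mul_assoc, hxp, mul_zero]
    calc δ = star β * (a * aco * (1 - a * aco)) * β
          + star β * star aco * star e * (1 - a * aco) * β := by rw [hδ, h0]; simp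
      _ = star (a * aco * β + e * aco * β) * ((1 - a * aco) * β) := by
          rw [star_add, star_mul (a * aco), hstar, star_mul (e * aco), star_mul e]
          noncomm_ring
      _ = _ := by rw [← hP, hfy]; noncomm_ring
  rw [hγ', hσ', hδ']
  exact exists_isCoreInverse_iff_of_reflexive_inverse hfyf hstar hPp hpP hQp hpQ
end

section
/- Let R be a unital ring with involution, a ∈ R core invertible with core inverse a^co, and e ∈ R such that 1 + a^co e is invertible. With α = (1 + a^co e)⁻¹, β = (1 + e a^co)⁻¹, ε = (1 − a a^co) e α (1 − a^co a), f = a + e − ε, γ = α(1 − a^co a) β⁻¹ a a^co β, σ = α a^co a α⁻¹ (1 − a a^co) β, and δ = β* (a^co)* e* (1 − a a^co) β: if 1 − γ has a left inverse and 1 − σ and 1 − δ each have a right inverse, then f is core invertible. -/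
/-- A strongly regular element whose right ideal is generated by a projection is core
invertible. -/
theorem isCoreInverse_of_projection {R : Type*} [Ring R] [StarRing R] {f s t u h : R}
    (hs : f * f * s = f) (ht : t * (f * f) = f) (hh : f * u = h) (hstar : star h = h)
    (hhf : h * f = f) : IsCoreInverse f (t * h) := by
  have hts : t * f = f * s := by
    calc t * f = t * (f * f * s) := by rw [hs]
      _ = t * (f * f) * s := by simp only [mul_assoc]
      _ = f * s := by rw [ht]
  have hfX : f * (t * h) = h := by
    calc f * (t * h) = f * (t * f) * u := by rw [← hh]; simp only [mul_assoc]
      _ = f * f * s * u := by rw [hts]; simp only [mul_assoc]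
      _ = h := by rw [hs, hh]
  have hidem : h * h = h := by
    nth_rewrite 2 [← hh]
    rw [← mul_assoc, hhf, hh]
  have hht : h * (t * h) = t * h := by
    have hth : t * h = f * (s * u) := by rw [← hh, ← mul_assoc, hts, mul_assoc]
    rw [hth, ← mul_assoc, hhf]
  refine ⟨by rw [hfX, hhf], by rw [mul_assoc, hfX, mul_assoc, hidem], by rw [hfX, hstar], ?_, ?_⟩
  · rw [← mul_assoc, hfX, hht]
  · rw [mul_assoc, ← mul_assoc h, hhf, ht]

/-- If `1 - star P * (1 - P)` is right invertible for an idempotent `P`, then the right ideal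
generated by `P` is generated by a projection. -/
theorem exists_projection_of_right_inverse {R : Type*} [Ring R] [StarRing R] {P v : R}
    (hP : P * P = P) (hv : (1 - star P * (1 - P)) * v = 1) :
    star (P * v) = P * v ∧ P * v * P = P := by
  have hPs : star P * star P = star P := by rw [← star_mul, hP]
  have h1 : star P * (P * v) = star P := by
    calc star P * (P * v)
        = (star P - star P * star P * (1 - P)) * v := by rw [hPs]; noncomm_ring
      _ = star P * ((1 - star P * (1 - P)) * v) := by noncomm_ring
      _ = star P := by rw [hv, mul_one]
  have h2 : star (P * v) * (P * v) = star (P * v) := by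
    rw [star_mul, mul_assoc, h1]
  have h3 : star (P * v) = P * v := by
    have := congrArg star h2
    rw [star_mul, star_star] at this
    exact h2.symm.trans this
  refine ⟨h3, ?_⟩
  have := congrArg star h1
  rwa [star_mul, star_star, h3] at this

/-- A reflexively regular element `f` with reflexive inverse `y` is core invertible when the
idempotents `f * y` and `y * f` satisfy three one-sided invertibility conditions. -/
theorem exists_isCoreInverse_of_one_sided {R : Type*} [Ring R] [StarRing R] {f y w v v' : R}
    (hf : f * y * f = f) (hw : w * (1 - (1 - y * f) * (f * y)) = 1)
    (hv : (1 - y * f * (1 - f * y)) * v = 1)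
    (hv' : (1 - star (f * y) * (1 - f * y)) * v' = 1) :
    ∃ x, IsCoreInverse f x := by
  have hP : f * y * (f * y) = f * y := by rw [← mul_assoc, hf]
  have hQ : y * f * (y * f) = y * f := by rw [mul_assoc, ← mul_assoc f, hf]
  obtain ⟨h1, h2⟩ := exists_projection_of_right_inverse hP hv'
  have ht : w * (y * f) * (f * y) = f * y := by
    calc w * (y * f) * (f * y)
        = w * (f * y - (1 - y * f) * (f * y)) := by noncomm_ring
      _ = w * (f * y - (1 - y * f) * (f * y * (f * y))) := by rw [hP]
      _ = w * (1 - (1 - y * f) * (f * y)) * (f * y) := by noncomm_ring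
      _ = f * y := by rw [hw, one_mul]
  have hs : y * f * (f * y * v) = y * f := by
    calc y * f * (f * y * v)
        = (y * f - y * f * (1 - f * y)) * v := by noncomm_ring
      _ = (y * f - y * f * (y * f) * (1 - f * y)) * v := by rw [hQ]
      _ = y * f * ((1 - y * f * (1 - f * y)) * v) := by noncomm_ring
      _ = y * f := by rw [hv, mul_one]
  refine ⟨_, isCoreInverse_of_projection (f := f) (s := y * v) (t := w * y) (u := y * v')
    (h := f * y * v') ?_ ?_ (by rw [mul_assoc]) h1 ?_⟩
  · calc f * f * (y * v) = f * y * f * (f * (y * v)) := by rw [hf, mul_assoc]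
      _ = f * (y * f * (f * y * v)) := by simp only [mul_assoc]
      _ = f := by rw [hs, ← mul_assoc, hf]
  · calc w * y * (f * f) = w * y * (f * (f * y * f)) := by rw [hf]
      _ = w * (y * f) * (f * y) * f := by simp only [mul_assoc]
      _ = f := by rw [ht, hf]
  · calc f * y * v' * f = f * y * v' * (f * y * f) := by rw [hf]
      _ = f * y * v' * (f * y) * f := by simp only [mul_assoc]
      _ = f := by rw [h2, hf]

/-- if `1 - γ` is left invertible and `1 - σ`, `1 - δ` are right
invertible, then `f` is core invertible. -/
theorem sum_core_invertible_of_one_sided {R : Type*} [Ring R] [StarRing R] (a aco e : R)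
    (ha : IsCoreInverse a aco)
    (hu : IsUnit (1 + aco * e))
    (α β ε f γ σ δ : R)
    (hα : α = Ring.inverse (1 + aco * e))
    (hβ : β = Ring.inverse (1 + e * aco))
    (hε : ε = (1 - a * aco) * e * α * (1 - aco * a))
    (hf : f = a + e - ε)
    (hγ : γ = α * (1 - aco * a) * (1 + e * aco) * (a * aco) * β)
    (hσ : σ = α * (aco * a) * (1 + aco * e) * (1 - a * aco) * β)
    (hδ : δ = star β * star aco * star e * (1 - a * aco) * β)
    (hγl : ∃ w, w * (1 - γ) = 1)
    (hσr : ∃ v, (1 - σ) * v = 1)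
    (hδr : ∃ v, (1 - δ) * v = 1) :
    ∃ x, IsCoreInverse f x := by
  obtain ⟨h1, h2, h3, -, -⟩ := ha
  have hα1 : (1 + aco * e) * α = 1 := by rw [hα]; exact Ring.mul_inverse_cancel _ hu
  have hα2 : α * (1 + aco * e) = 1 := by rw [hα]; exact Ring.inverse_mul_cancel _ hu
  have hB1 : (1 + e * aco) * (1 - e * α * aco) = 1 := by
    calc (1 + e * aco) * (1 - e * α * aco)
        = 1 + e * aco - e * ((1 + aco * e) * α) * aco := by noncomm_ring
      _ = 1 := by rw [hα1]; noncomm_ring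
  have hB2 : (1 - e * α * aco) * (1 + e * aco) = 1 := by
    calc (1 - e * α * aco) * (1 + e * aco)
        = 1 + e * aco - e * (α * (1 + aco * e)) * aco := by noncomm_ring
      _ = 1 := by rw [hα2]; noncomm_ring
  have hβ' : β = 1 - e * α * aco := by
    rw [hβ]
    exact Ring.inverse_unit ⟨1 + e * aco, 1 - e * α * aco, hB1, hB2⟩
  have hβ1 : (1 + e * aco) * β = 1 := by rw [hβ', hB1]
  have hβ2 : β * (1 + e * aco) = 1 := by rw [hβ', hB2]
  have hxβ : aco * β = α * aco := by
    calc aco * β = α * (1 + aco * e) * (aco * β) := by rw [hα2, one_mul]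
      _ = α * aco * ((1 + e * aco) * β) := by noncomm_ring
      _ = α * aco := by rw [hβ1, mul_one]
  have hβe : β * e = e * α := by
    calc β * e = β * e * ((1 + aco * e) * α) := by rw [hα1, mul_one]
      _ = β * (1 + e * aco) * (e * α) := by noncomm_ring
      _ = e * α := by rw [hβ2, one_mul]
  have hxp : aco * (1 - a * aco) = 0 := by rw [mul_sub, ← mul_assoc, h2, mul_one, sub_self]
  have hqx : (1 - aco * a) * aco = 0 := by rw [sub_mul, h2, one_mul, sub_self]
  have hpa : (1 - a * aco) * a = 0 := by rw [sub_mul, h1, one_mul, sub_self]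
  have hpp : (1 - a * aco) * (1 - a * aco) = 1 - a * aco := by
    rw [mul_sub _ _ (a * aco), ← mul_assoc, hpa, zero_mul, mul_one, sub_zero]
  have hBp : (1 + e * aco) * (1 - a * aco) = 1 - a * aco := by
    rw [add_mul, mul_assoc, hxp, one_mul, mul_zero, add_zero]
  have hβp : β * (1 - a * aco) = 1 - a * aco := by
    nth_rewrite 1 [← hBp]
    rw [← mul_assoc, hβ2, one_mul]
  have hqA : (1 - aco * a) * (1 + aco * e) = 1 - aco * a := by
    rw [mul_add, ← mul_assoc, hqx, mul_one, zero_mul, add_zero]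
  have hqα : (1 - aco * a) * α = 1 - aco * a := by
    nth_rewrite 1 [← hqA]
    rw [mul_assoc, hα1, mul_one]
  have hεy : ε * (α * aco) = 0 := by
    rw [hε, mul_assoc, ← mul_assoc (1 - aco * a), hqα, hqx, mul_zero]
  have hyε : α * aco * ε = 0 := by
    calc α * aco * ε = α * (aco * (1 - a * aco)) * (e * α * (1 - aco * a)) := by
          rw [hε]; simp only [mul_assoc]
      _ = 0 := by rw [hxp, mul_zero, zero_mul]
  have hfy : f * (α * aco) = 1 - (1 - a * aco) * β := by
    calc f * (α * aco) = (a + e) * (α * aco) - ε * (α * aco) := by rw [hf, sub_mul]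
      _ = (a + e) * (aco * β) := by rw [hεy, sub_zero, hxβ]
      _ = (1 + e * aco) * β - (1 - a * aco) * β := by noncomm_ring
      _ = 1 - (1 - a * aco) * β := by rw [hβ1]
  have hyf : α * aco * f = 1 - α * (1 - aco * a) := by
    calc α * aco * f = α * aco * (a + e) - α * aco * ε := by rw [hf, mul_sub]
      _ = α * (1 + aco * e) - α * (1 - aco * a) := by rw [hyε]; noncomm_ring
      _ = 1 - α * (1 - aco * a) := by rw [hα2]
  have hpβa : (1 - a * aco) * β * a = -((1 - a * aco) * (e * α) * (aco * a)) := by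
    calc (1 - a * aco) * β * a = (1 - a * aco) * a - (1 - a * aco) * (e * α) * (aco * a) := by
          rw [hβ']; noncomm_ring
      _ = _ := by rw [hpa, zero_sub]
  have hpβε : (1 - a * aco) * β * ε = (1 - a * aco) * (e * α) * (1 - aco * a) := by
    calc (1 - a * aco) * β * ε
        = (1 - a * aco) * (β * (1 - a * aco)) * (e * α) * (1 - aco * a) := by
          rw [hε]; simp only [mul_assoc]
      _ = _ := by rw [hβp, hpp]
  have hNf : (1 - a * aco) * β * f = 0 := by
    calc (1 - a * aco) * β * f
        = (1 - a * aco) * β * a + (1 - a * aco) * (β * e) - (1 - a * aco) * β * ε := by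
          rw [hf]; noncomm_ring
      _ = 0 := by rw [hpβa, hβe, hpβε]; noncomm_ring
  have hfyf : f * (α * aco) * f = f := by rw [hfy, sub_mul, hNf, one_mul, sub_zero]
  have hγ' : γ = (1 - α * aco * f) * (f * (α * aco)) := by
    calc γ = α * (1 - aco * a)
          * ((1 + e * aco) * β - (1 + e * aco) * (1 - a * aco) * β) := by
          rw [hγ]; noncomm_ring
      _ = _ := by rw [hβ1, hBp, hyf, hfy, sub_sub_cancel]
  have hσ' : σ = α * aco * f * (1 - f * (α * aco)) := by
    calc σ = (α * (1 + aco * e) - α * ((1 - aco * a) * (1 + aco * e)))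
          * ((1 - a * aco) * β) := by
          rw [hσ]; noncomm_ring
      _ = _ := by rw [hα2, hqA, hyf, hfy, sub_sub_cancel]
  have hps : star (1 - a * aco) = 1 - a * aco := by rw [star_sub, star_one, h3]
  have heβ : e * aco * β = 1 - β := by
    calc e * aco * β = (1 + e * aco) * β - β := by noncomm_ring
      _ = 1 - β := by rw [hβ1]
  have hδ' : δ = star (f * (α * aco)) * (1 - f * (α * aco)) := by
    have hs : star β * star aco * star e = 1 - star β := by
      rw [mul_assoc, ← star_mul, ← star_mul, heβ, star_sub, star_one]
    calc δ = (1 - star β) * ((1 - a * aco) * β) := by rw [hδ, hs, mul_assoc]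
      _ = (1 - a * aco) * β - star β * (1 - a * aco) * β := by noncomm_ring
      _ = (1 - a * aco) * β - star β * ((1 - a * aco) * (1 - a * aco)) * β := by rw [hpp]
      _ = (1 - star β * (1 - a * aco)) * ((1 - a * aco) * β) := by
          simp only [sub_mul (1 : R) (star β * _), one_mul, mul_assoc]
      _ = _ := by rw [hfy, sub_sub_cancel, star_sub, star_one, star_mul, hps]
  obtain ⟨w, hw⟩ := hγl
  obtain ⟨v, hv⟩ := hσr
  obtain ⟨v', hv'⟩ := hδr
  rw [hγ'] at hw
  rw [hσ'] at hv
  rw [hδ'] at hv'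
  exact exists_isCoreInverse_of_one_sided hfyf hw hv hv'
end

section
/- Let R be a unital ring with involution, a ∈ R core invertible with core inverse a^co, and e ∈ R such that 1 + a^co e is invertible. With α = (1 + a^co e)⁻¹, β = (1 + e a^co)⁻¹, ε = (1 − a a^co) e α (1 − a^co a), f = a + e − ε, γ = α(1 − a^co a) β⁻¹ a a^co β, and δ = β* (a^co)* e* (1 − a a^co) β: if f is core invertible, then 1 − γ and 1 − δ are invertible and the core inverse of f is f^co = (1 − γ)⁻¹ α a^co (1 − δ)⁻¹. -/
theorem one_add_mul_mul_one_sub_eq_one {R : Type*} [Ring R] {x e α : R}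
    (h : (1 + x * e) * α = 1) : (1 + e * x) * (1 - e * α * x) = 1 := by
  calc (1 + e * x) * (1 - e * α * x) = 1 + e * x - e * ((1 + x * e) * α) * x := by noncomm_ring
    _ = 1 := by rw [h]; noncomm_ring

theorem one_sub_mul_one_add_mul_eq_one {R : Type*} [Ring R] {x e α : R}
    (h : α * (1 + x * e) = 1) : (1 - e * α * x) * (1 + e * x) = 1 := by
  calc (1 - e * α * x) * (1 + e * x) = 1 + e * x - e * (α * (1 + x * e)) * x := by noncomm_ring
    _ = 1 := by rw [h]; noncomm_ring

theorem Ring.inverse_eq_of_mul_eq_one {R : Type*} [Ring R] {u v : R}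
    (huv : u * v = 1) (hvu : v * u = 1) : Ring.inverse u = v :=
  Ring.inverse_unit (⟨u, v, huv, hvu⟩ : Rˣ)

/-- An idempotent `F` with the same kernel as the projection `p` and the same range as the
projection `P`. -/
theorem one_sub_star_mul_one_sub_inverse {R : Type*} [Ring R] [StarRing R] {p F P : R}
    (hp : star p = p) (hP : star P = P) (hpF : p * F = p) (hFp : F * p = F)
    (hPF : P * F = F) (hFP : F * P = P) :
    (1 - star F * (1 - F)) * (1 - p + p * P) = 1 ∧
      (1 - p + p * P) * (1 - star F * (1 - F)) = 1 := by
  have h1 : star F * p = p := by simpa [hp] using congrArg star hpF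
  have h2 : p * star F = star F := by simpa [hp] using congrArg star hFp
  have h3 : star F * P = star F := by simpa [hP] using congrArg star hPF
  have h4 : P * star F = P := by simpa [hP] using congrArg star hFP
  generalize star F = F' at *
  constructor
  · calc (1 - F' * (1 - F)) * (1 - p + p * P)
        = 1 - p + p * P - F' + F' * p - (F' * p) * P + F' * F - F' * (F * p)
          + F' * ((F * p) * P) := by noncomm_ring
      _ = 1 := by rw [h1, hFp, hFP, h3]; abel
  · calc (1 - p + p * P) * (1 - F' * (1 - F))
        = 1 - p + p * P - F' + p * F' - p * (P * F') + F' * F - (p * F') * F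
          + p * ((P * F') * F) := by noncomm_ring
      _ = 1 := by rw [h2, h4, hPF, hpF]; abel

/-- Idempotents `F`, `G`, `Q` such that `F` has the kernel of `p`, `G` has the range of `p`,
and `Q` has the range of `F` and the kernel of `G`. -/
theorem one_sub_one_sub_mul_inverse {R : Type*} [Ring R] {p F G Q : R}
    (hFp : F * p = F) (hpF : p * F = p) (hpG : p * G = G) (hGp : G * p = p)
    (hQF : Q * F = F) (hFQ : F * Q = Q) (hQG : Q * G = Q) (hGQ : G * Q = G) :
    (1 - (1 - G) * F) * (1 - p + Q * p) = 1 ∧ (1 - p + Q * p) * (1 - (1 - G) * F) = 1 := by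
  constructor
  · calc (1 - (1 - G) * F) * (1 - p + Q * p)
        = 1 - p + Q * p - F + F * p - (F * Q) * p + G * F - G * (F * p)
          + G * (F * Q) * p := by noncomm_ring
      _ = 1 := by rw [hFQ, hFp, hGQ, hGp]; abel
  · calc (1 - p + Q * p) * (1 - (1 - G) * F)
        = 1 - p + Q * p - F + p * F - Q * (p * F) + G * F - (p * G) * F
          + Q * (p * G) * F := by noncomm_ring
      _ = 1 := by rw [hpF, hpG, hQG, hQF]; abel

/-- if `f` is core invertible, then `1 - γ` and `1 - δ` are invertible
and `f^co = (1 - γ)⁻¹ * α * a^co * (1 - δ)⁻¹`. -/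
theorem sum_core_inverse_formula {R : Type*} [Ring R] [StarRing R] (a aco e : R)
    (ha : IsCoreInverse a aco)
    (hu : IsUnit (1 + aco * e))
    (α β ε f γ δ fco : R)
    (hα : α = Ring.inverse (1 + aco * e))
    (hβ : β = Ring.inverse (1 + e * aco))
    (hε : ε = (1 - a * aco) * e * α * (1 - aco * a))
    (hf : f = a + e - ε)
    (hγ : γ = α * (1 - aco * a) * (1 + e * aco) * (a * aco) * β)
    (hδ : δ = star β * star aco * star e * (1 - a * aco) * β)
    (hfco : IsCoreInverse f fco) :
    IsUnit (1 - γ) ∧ IsUnit (1 - δ) ∧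
    fco = Ring.inverse (1 - γ) * α * aco * Ring.inverse (1 - δ) := by
  obtain ⟨axa, xax, hp, axx, xaa⟩ := ha
  obtain ⟨fzf, zfz, hP, fzz, zff⟩ := hfco
  have hα₁ : (1 + aco * e) * α = 1 := hα ▸ Ring.mul_inverse_cancel _ hu
  have hα₂ : α * (1 + aco * e) = 1 := hα ▸ Ring.inverse_mul_cancel _ hu
  have hβ' : β = 1 - e * α * aco := hβ.trans <| Ring.inverse_eq_of_mul_eq_one
    (one_add_mul_mul_one_sub_eq_one hα₁) (one_sub_mul_one_add_mul_eq_one hα₂)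
  have hβ₁ : (1 + e * aco) * β = 1 := hβ' ▸ one_add_mul_mul_one_sub_eq_one hα₁
  have hαl : α = 1 - aco * e * α := by rw [eq_sub_iff_add_eq, ← hα₁]; noncomm_ring
  have hαβ : α * aco = aco * β := by
    calc α * aco = α * aco * ((1 + e * aco) * β) := by rw [hβ₁, mul_one]
      _ = (α * (1 + aco * e)) * aco * β := by noncomm_ring
      _ = aco * β := by rw [hα₂, one_mul]
  have hxp : aco * (1 - a * aco) = 0 := by rw [mul_sub, ← mul_assoc, xax, mul_one, sub_self]
  have hqx : (1 - aco * a) * aco = 0 := by rw [sub_mul, xax, one_mul, sub_self]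
  have hqα : (1 - aco * a) * α = 1 - aco * a := by
    calc (1 - aco * a) * α = (1 - aco * a) * (1 - aco * e * α) := by rw [← hαl]
      _ = (1 - aco * a) - (1 - aco * a) * aco * e * α := by noncomm_ring
      _ = 1 - aco * a := by rw [hqx]; noncomm_ring
  have hqp : aco * a * (a * aco) = a * aco := by
    rw [← mul_assoc, mul_assoc aco a a, xaa]
  have hpp : a * aco * (a * aco) = a * aco := by rw [← mul_assoc, axa]
  set p := a * aco with hp_def
  set q := aco * a with hq_def
  set y := α * aco with hy
  -- the idempotent `f * y`
  have hεy : ε * y = 0 := by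
    calc ε * y = (1 - p) * e * α * (((1 - q) * α) * aco) := by rw [hε, hy]; noncomm_ring
      _ = 0 := by rw [hqα, hqx, mul_zero]
  have hfy : f * y = (p + e * aco) * β := by
    rw [hf, sub_mul, hεy, sub_zero, hαβ, hp_def]; noncomm_ring
  have hF : f * y = 1 - (1 - p) * β := by
    calc f * y = (1 + e * aco) * β - (1 - p) * β := by rw [hfy]; noncomm_ring
      _ = 1 - (1 - p) * β := by rw [hβ₁]
  -- the idempotent `y * f`
  have hyε : y * ε = 0 := by
    calc y * ε = α * (aco * (1 - p)) * e * α * (1 - q) := by rw [hε, hy]; noncomm_ring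
      _ = 0 := by rw [hxp]; simp
  have hyf : y * (a + e) = 1 - α * (1 - q) := by
    calc y * (a + e) = α * (1 + aco * e) - α * (1 - q) := by rw [hy, hq_def]; noncomm_ring
      _ = 1 - α * (1 - q) := by rw [hα₂]
  have hG : y * f = 1 - α * (1 - q) := by rw [hf, mul_sub, hyε, sub_zero, hyf]
  have hpa : (1 - p) * a = 0 := by rw [sub_mul, hp_def, axa, one_mul, sub_self]
  have hpp' : (1 - p) * (1 - p) = 1 - p := by
    rw [mul_sub, sub_mul 1 p p, hpp]; simp
  have hpε : (1 - p) * ε = ε := by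
    rw [hε, ← mul_assoc, ← mul_assoc, ← mul_assoc, hpp']
  have hfyf : f * y * f = f := by
    have : (1 - p) * e * (y * f) = (1 - p) * f := by
      calc (1 - p) * e * (y * f) = (1 - p) * a + (1 - p) * e - ε := by
            rw [hG, hε, hpa]; noncomm_ring
        _ = (1 - p) * f := by rw [hf, mul_sub, hpε, mul_add]
    calc f * y * f = f - ((1 - p) * f - (1 - p) * e * (y * f)) := by
          rw [hF, hβ', hy]; noncomm_ring
      _ = f := by rw [this, sub_self, sub_zero]
  have hyp : y * (1 - p) = 0 := by rw [hy, mul_assoc, hxp, mul_zero]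
  have hyp' : y * p = y := by rw [mul_sub, mul_one, sub_eq_zero] at hyp; exact hyp.symm
  have hpx : p * aco = aco := by rw [hp_def, mul_assoc, axx]
  have hpy : p * y = y := by rw [hαβ, ← mul_assoc, hpx]
  have hpF : p * (f * y) = p := by
    rw [hF, mul_sub, ← mul_assoc, mul_sub, hpp]; simp
  have hFp : f * y * p = f * y := by rw [mul_assoc, hyp']
  have hpG : p * (y * f) = y * f := by rw [← mul_assoc, hpy]
  have hGp : y * f * p = p := by
    have : (1 - q) * p = 0 := by rw [sub_mul, hqp, one_mul, sub_self]
    rw [hG, sub_mul, mul_assoc, this]; simp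
  have hPF : f * fco * (f * y) = f * y := by rw [← mul_assoc, fzf]
  have hFP : f * y * (f * fco) = f * fco := by rw [← mul_assoc, hfyf]
  have hQF : fco * f * (f * y) = f * y := by
    rw [← mul_assoc, mul_assoc fco, zff]
  have hFQ : f * y * (fco * f) = fco * f := by
    calc f * y * (fco * f) = f * y * (f * (fco * fco) * f) := by rw [fzz]
      _ = (f * y * f) * (fco * fco) * f := by noncomm_ring
      _ = fco * f := by rw [hfyf, fzz]
  have hQG : fco * f * (y * f) = fco * f := by
    rw [mul_assoc, ← mul_assoc f, hfyf]
  have hGQ : y * f * (fco * f) = y * f := by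
    rw [mul_assoc, ← mul_assoc f, fzf]
  have hγ' : γ = (1 - y * f) * (f * y) := by
    have : (1 + e * aco) * p = p + e * aco := by
      rw [add_mul, one_mul, mul_assoc, hp_def, ← mul_assoc aco, xax]
    rw [hγ, hG, hfy, ← this]; noncomm_ring
  have hδ' : δ = star (f * y) * (1 - f * y) := by
    have h1 : star β * star aco * star e = 1 - star β := by
      have h : e * aco * β = 1 - β := by rw [eq_sub_iff_add_eq, ← hβ₁]; noncomm_ring
      simpa [mul_assoc] using congrArg star h
    have h2 : star (f * y) = 1 - star β * (1 - p) := by rw [hF]; simp [hp]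
    calc δ = (1 - star β) * ((1 - p) * β) := by rw [hδ, h1]; noncomm_ring
      _ = (1 - p) * β - star β * ((1 - p) * (1 - p)) * β := by rw [hpp']; noncomm_ring
      _ = star (f * y) * (1 - f * y) := by rw [h2, hF]; noncomm_ring
  obtain ⟨hγ₁, hγ₂⟩ := one_sub_one_sub_mul_inverse hFp hpF hpG hGp hQF hFQ hQG hGQ
  obtain ⟨hδ₁, hδ₂⟩ := one_sub_star_mul_one_sub_inverse hp hP hpF hFp hPF hFP
  rw [← hγ'] at hγ₁ hγ₂
  rw [← hδ'] at hδ₁ hδ₂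
  refine ⟨⟨⟨_, _, hγ₁, hγ₂⟩, rfl⟩, ⟨⟨_, _, hδ₁, hδ₂⟩, rfl⟩, ?_⟩
  rw [Ring.inverse_eq_of_mul_eq_one hγ₁ hγ₂, Ring.inverse_eq_of_mul_eq_one hδ₁ hδ₂,
    mul_assoc _ α, ← hy]
  symm
  calc (1 - p + fco * f * p) * y * (1 - p + p * (f * fco))
      = (y - p * y + fco * f * (p * y)) * (1 - p + p * (f * fco)) := by noncomm_ring
    _ = fco * f * (y * (1 - p)) + fco * f * (y * p) * (f * fco) := by rw [hpy]; noncomm_ring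
    _ = fco * (f * y * f) * fco := by rw [hyp, hyp']; noncomm_ring
    _ = fco := by rw [hfyf, zfz]
end

section
/- Let R be a unital ring with involution, a ∈ R core invertible with core inverse a^co, and e ∈ R such that 1 + a^co e is invertible. With α = (1 + a^co e)⁻¹, β = (1 + e a^co)⁻¹, ε = (1 − a a^co) e α (1 − a^co a), f = a + e − ε, γ = α(1 − a^co a) β⁻¹ a a^co β, σ = α a^co a α⁻¹ (1 − a a^co) β, and δ = β* (a^co)* e* (1 − a a^co) β: if f is core invertible with core inverse f^co, then (1 − γ)⁻¹ = 1 − a a^co + f^co f a a^co, (1 − σ)⁻¹ = 1 − a a^co + a a^co f^co f, and (1 − δ)⁻¹ = 1 − a a^co + a a^co f f^co. -/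
theorem isUnit_and_inverse_eq_of_mul_eq_one {R : Type*} [Ring R] {x y : R}
    (hxy : x * y = 1) (hyx : y * x = 1) : IsUnit x ∧ Ring.inverse x = y :=
  ⟨⟨⟨x, y, hxy, hyx⟩, rfl⟩, Ring.inverse_unit ⟨x, y, hxy, hyx⟩⟩

theorem inverse_one_add_mul_swap {R : Type*} [Ring R] {x e : R} (h : IsUnit (1 + x * e)) :
    Ring.inverse (1 + e * x) = 1 - e * Ring.inverse (1 + x * e) * x := by
  have h₁ := Ring.mul_inverse_cancel _ h
  have h₂ := Ring.inverse_mul_cancel _ h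
  refine (isUnit_and_inverse_eq_of_mul_eq_one ?_ ?_).2
  · linear_combination (norm := noncomm_ring) -e * h₁ * x
  · linear_combination (norm := noncomm_ring) -e * h₂ * x

/-- `Q` is an idempotent whose range is the graph of `n` over the range of `p`, and `E` is the
idempotent with the range of `p` and the kernel of `Q`. -/
theorem isUnit_and_inverse_one_sub_compl_mul {R : Type*} [Ring R] {p n Q E : R}
    (hpn : p * n = 0) (hnp : n * p = n)
    (hnQ : n * Q = (1 - p) * Q) (hQ : Q * (p + n) = p + n)
    (hEp : E * p = p) (hpE : p * E = E) (hEQ : E * Q = E) (hQE : Q * E = Q) :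
    IsUnit (1 - (1 - E) * n) ∧
      Ring.inverse (1 - (1 - E) * n) = 1 - p + Q * p := by
  apply isUnit_and_inverse_eq_of_mul_eq_one
  · linear_combination (norm := noncomm_ring)
      (1 - E) * hnp - (1 - E) * hnQ * p + hEQ * p - hEp * Q * p + hEp
  · linear_combination (norm := noncomm_ring)
      hQ + (1 - Q) * hpn + (Q - 1) * hpE * n + hQE * n

/-- `Q` is an idempotent whose range is the graph of `n` over the range of `p`, and `E` is the
idempotent with the range of `p` and the kernel of `Q`. -/
theorem isUnit_and_inverse_one_sub_mul_compl_sub {R : Type*} [Ring R] {p n Q E : R}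
    (hpp : p * p = p) (hpn : p * n = 0) (hnp : n * p = n)
    (hnQ : n * Q = (1 - p) * Q) (hQ : Q * (p + n) = p + n)
    (hEp : E * p = p) (hpE : p * E = E) (hEQ : E * Q = E) (hQE : Q * E = Q) :
    IsUnit (1 - E * (1 - p - n)) ∧
      Ring.inverse (1 - E * (1 - p - n)) = 1 - p + p * Q := by
  apply isUnit_and_inverse_eq_of_mul_eq_one
  · linear_combination (norm := noncomm_ring)
      E * hpp * Q - E * hpp - E * hnp + E * hnp * Q + E * hnQ + hEQ + hEp - hEp * Q
  · linear_combination (norm := noncomm_ring)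
      hpE - hpE * p - hpE * n - p * hQE + p * hQE * p + p * hQE * n + p * hQ + hpp + hpn

/-- `P` is the projection whose range is the graph of `n` over the range of `p`. -/
theorem isUnit_and_inverse_one_sub_star_mul {R : Type*} [Ring R] [StarRing R] {p n P : R}
    (hp : star p = p) (hP' : star P = P)
    (hpp : p * p = p) (hpn : p * n = 0) (hnp : n * p = n)
    (hnP : n * P = (1 - p) * P) (hP : P * (p + n) = p + n) :
    IsUnit (1 - star n * (1 - p - n)) ∧
      Ring.inverse (1 - star n * (1 - p - n)) = 1 - p + p * P := by
  have hmp : star n * p = 0 := by simpa [hp] using congrArg star hpn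
  have hpm : p * star n = star n := by simpa [hp] using congrArg star hnp
  have hPm : P * star n = P * (1 - p) := by simpa [hp, hP'] using congrArg star hnP
  have hmP : (p + star n) * P = p + star n := by simpa [hp, hP'] using congrArg star hP
  apply isUnit_and_inverse_eq_of_mul_eq_one
  · linear_combination (norm := noncomm_ring)
      2 * hmp - hmp * p + hmp * p * P - 2 * hmp * P - star n * hnp + star n * hnp * P
        + star n * hnP + hmP
  · linear_combination (norm := noncomm_ring)
      hmp - p * hmp + p * P * hmp + hpm - hpm * n - p * hPm + p * hPm * n + p * hP
        - p * P * hpn + hpp + hpn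

/-- expressions for `(1 - γ)⁻¹`, `(1 - σ)⁻¹` and `(1 - δ)⁻¹` when `f`
is core invertible with core inverse `f^co`. -/
theorem sum_core_resolvent_formulas {R : Type*} [Ring R] [StarRing R] (a aco e : R)
    (ha : IsCoreInverse a aco)
    (hu : IsUnit (1 + aco * e))
    (α β ε f γ σ δ fco : R)
    (hα : α = Ring.inverse (1 + aco * e))
    (hβ : β = Ring.inverse (1 + e * aco))
    (hε : ε = (1 - a * aco) * e * α * (1 - aco * a))
    (hf : f = a + e - ε)
    (hγ : γ = α * (1 - aco * a) * (1 + e * aco) * (a * aco) * β)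
    (hσ : σ = α * (aco * a) * (1 + aco * e) * (1 - a * aco) * β)
    (hδ : δ = star β * star aco * star e * (1 - a * aco) * β)
    (hfco : IsCoreInverse f fco) :
    IsUnit (1 - γ) ∧ IsUnit (1 - σ) ∧ IsUnit (1 - δ) ∧
    Ring.inverse (1 - γ) = 1 - a * aco + fco * f * (a * aco) ∧
    Ring.inverse (1 - σ) = 1 - a * aco + a * aco * (fco * f) ∧
    Ring.inverse (1 - δ) = 1 - a * aco + a * aco * (f * fco) := by
  obtain ⟨haxa, hxax, hp, haxx, hxaa⟩ := ha
  obtain ⟨hfyf, -, hP', hfyy, hyff⟩ := hfco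
  have hvα := Ring.mul_inverse_cancel _ hu
  have hαv := Ring.inverse_mul_cancel _ hu
  rw [inverse_one_add_mul_swap hu] at hβ
  rw [← hα] at hvα hαv hβ
  obtain ⟨p, hpdef⟩ : ∃ p, p = a * aco := ⟨_, rfl⟩
  obtain ⟨n, hn⟩ : ∃ n, n = (1 - p) * (e * α * aco) := ⟨_, rfl⟩
  obtain ⟨E, hE⟩ : ∃ E, E = α * (aco * a) * (1 + aco * e) := ⟨_, rfl⟩
  rw [← hpdef] at hp haxa hε hγ hσ hδ ⊢
  have hxp : aco * p = aco := by rw [hpdef, ← mul_assoc, hxax]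
  have hpx : p * aco = aco := by rw [hpdef, mul_assoc, haxx]
  have hqp : aco * a * p = p := by
    linear_combination (norm := (rw [hpdef]; noncomm_ring)) hxaa * aco
  have hpp : p * p = p := by
    linear_combination (norm := (rw [hpdef]; noncomm_ring)) haxa * aco
  have hpn : p * n = 0 := by
    linear_combination (norm := (rw [hn]; noncomm_ring)) -hpp * (e * α * aco)
  have hnp : n * p = n := by
    linear_combination (norm := (rw [hn]; noncomm_ring)) (1 - p) * (e * α) * hxp
  have hxβ : aco * β = α * aco := by
    linear_combination (norm := (rw [hβ]; noncomm_ring)) -hvα * aco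
  have hβn : (1 - p) * β = 1 - p - n := by rw [hβ, hn]; noncomm_ring
  have hEc : 1 - E = α * (1 - aco * a) := by
    linear_combination (norm := (rw [hE]; noncomm_ring)) -hαv - α * hxax * e
  have hEp : E * p = p := by
    linear_combination (norm := noncomm_ring) -hEc * p + α * hqp
  have hpE : p * E = E := by
    have hE' : E = aco * (β * a * (1 + aco * e)) := by
      linear_combination (norm := (rw [hE]; noncomm_ring)) -hxβ * (a * (1 + aco * e))
    rw [hE', ← mul_assoc, hpx]
  have hff : f = (1 + n) * (a * (1 + aco * e)) := by
    linear_combination (norm := (rw [hf, hε, hn]; noncomm_ring))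
      -(1 - p) * e * hαv - (1 - p) * e * α * hxax * e + hpdef * e
  have hpf : p * f = a * (1 + aco * e) := by
    linear_combination (norm := noncomm_ring)
      p * hff + (haxa + hpn * a) * (1 + aco * e)
  have hnf : n * f = (1 - p) * f := by
    linear_combination (norm := noncomm_ring) (1 + n) * hpf - hff - hnp * f
  have hfαx : f * (α * aco) = p + n := by
    linear_combination (norm := (rw [hpdef]; noncomm_ring))
      hff * (α * aco) + (1 + n) * a * hvα * aco + hnp - n * hpdef
  have hEf : E = α * aco * (p * f) := by rw [hpf, hE]; noncomm_ring
  have hfE : f * (1 - E) = 0 := by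
    linear_combination (norm := noncomm_ring) f * hEc + hff * (α * (1 - aco * a))
      + (1 + n) * a * hvα * (1 - aco * a) - (1 + n) * haxa + (1 + n) * hpdef * a
  have hP : f * fco * (p + n) = p + n := by
    rw [← hfαx, ← mul_assoc, hfyf]
  have hQ : fco * f * (p + n) = p + n := by
    rw [← hfαx, ← mul_assoc, mul_assoc fco, hyff]
  have hnP : n * (f * fco) = (1 - p) * (f * fco) := by
    rw [← mul_assoc, hnf, mul_assoc]
  have hnQ : n * (fco * f) = (1 - p) * (fco * f) := by
    rw [← hfyy]
    linear_combination (norm := noncomm_ring) hnf * (fco * fco * f)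
  have hEQ : E * (fco * f) = E := by
    linear_combination (norm := noncomm_ring)
      hEf * (fco * f) + α * aco * p * hfyf - hEf
  have hQE : fco * f * E = fco * f := by
    linear_combination (norm := noncomm_ring) -fco * hfE
  have hγn : γ = (1 - E) * n := by
    rw [hγ, ← hEc, hn]
    linear_combination (norm := noncomm_ring)
      (1 - E) * e * hxp * β + (1 - E) * e * hxβ - hEp * β - hEp * (e * α * aco)
  have hσn : σ = E * (1 - p - n) := by
    rw [hσ, ← hβn, hE, mul_assoc _ (1 - p)]
  have hδn : δ = star n * (1 - p - n) := by
    have hstar : star n = star β * star aco * star e * (1 - p) := by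
      have h : n = (1 - p) * (e * (aco * β)) := by rw [hn, hxβ, mul_assoc e]
      rw [h]
      simp only [star_mul, star_sub, star_one, hp, mul_assoc]
    rw [hδ, ← hβn, hstar]
    linear_combination (norm := noncomm_ring) -(star β * star aco * star e) * hpp * β
  obtain ⟨hγu, hγi⟩ := isUnit_and_inverse_one_sub_compl_mul hpn hnp hnQ hQ hEp hpE hEQ hQE
  obtain ⟨hσu, hσi⟩ :=
    isUnit_and_inverse_one_sub_mul_compl_sub hpp hpn hnp hnQ hQ hEp hpE hEQ hQE
  obtain ⟨hδu, hδi⟩ := isUnit_and_inverse_one_sub_star_mul hp hP' hpp hpn hnp hnP hP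
  rw [← hγn] at hγu hγi
  rw [← hσn] at hσu hσi
  rw [← hδn] at hδu hδi
  exact ⟨hγu, hσu, hδu, hγi, hσi, hδi⟩
end

section
/- Let R be a unital ring with involution, a ∈ R dual core invertible with dual core inverse a_co, and e ∈ R such that 1 + a_co e is invertible. With α = (1 + a_co e)⁻¹, β = (1 + e a_co)⁻¹, ε = (1 − a a_co) e α (1 − a_co a), f = a + e − ε, ρ = α a_co a α⁻¹ (1 − a a_co) β, ζ = α(1 − a_co a) β⁻¹ a a_co β, and ξ = α(1 − a_co a) e* (a_co)* α*, the following are equivalent: (i) f is dual core invertible; (ii) 1 − ρ, 1 − ζ, and 1 − ξ are all invertible; (iii) 1 − ρ has a right inverse and 1 − ζ and 1 − ξ each have a left inverse. -/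
/-- `x` is the dual core inverse of `a`. -/
def IsDualCoreInverse {R : Type*} [Ring R] [StarRing R] (a x : R) : Prop :=
  a * x * a = a ∧ x * a * x = x ∧ star (x * a) = x * a ∧ x * x * a = x ∧ a * a * x = a

/-- If `f ∈ f²R ∩ Rf² ∩ f f* R`, then `f` is dual core invertible. -/
theorem isDualCoreInverse_of_factorizations {R : Type*} [Ring R] [StarRing R] {f u w z : R}
    (hu : f * f * u = f) (hw : w * f * f = f) (hz : f * star f * z = f) :
    IsDualCoreInverse f (star z * f * u) := by
  have hfu : f * u = w * f := by
    calc f * u = w * f * f * u := by rw [hw]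
      _ = w * (f * f * u) := by noncomm_ring
      _ = w * f := by rw [hu]
  have hz' : star z * f * star f = star f := by
    simpa [mul_assoc] using congrArg star hz
  have hsym : star z * f = star f * z := by
    calc star z * f = star z * (f * star f * z) := by rw [hz]
      _ = star z * f * star f * z := by noncomm_ring
      _ = star f * z := by rw [hz']
  have hinner : f * (star z * f) = f := by rw [hsym, ← mul_assoc, hz]
  have hx : star z * f * u = star z * w * f := by rw [mul_assoc, hfu, ← mul_assoc]
  have hxf : star z * f * u * f = star z * f := by
    rw [hx, mul_assoc, mul_assoc, ← mul_assoc w, hw]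
  refine ⟨?_, ?_, ?_, ?_, ?_⟩
  · rw [mul_assoc, hxf, hinner]
  · rw [hxf, mul_assoc (star z), ← mul_assoc f (star z * f), hinner, mul_assoc]
  · rw [hxf, star_mul, star_star, hsym]
  · rw [mul_assoc, hxf, hx, mul_assoc, hinner]
  · calc f * f * (star z * f * u) = f * (f * (star z * f)) * u := by noncomm_ring
      _ = f := by rw [hinner, hu]

/-- For idempotents `E`, `F` with `RE = Rq` and `FR = qR`, an idempotent `P` with `PR = ER`
and `RP = RF` makes `1 - F (1 - E)` invertible. -/
theorem isUnit_one_sub_mul_one_sub {R : Type*} [Ring R] {E F P q : R}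
    (hqE : q * E = q) (hEq : E * q = E) (hFq : F * q = q) (hqF : q * F = F)
    (hPE : P * E = E) (hEP : E * P = P) (hPF : P * F = P) (hFP : F * P = F) :
    IsUnit (1 - F * (1 - E)) := by
  refine isUnit_iff_exists.mpr ⟨q * P + 1 - q, ?_, ?_⟩
  · linear_combination (norm := noncomm_ring)
      -hFq * P + F * hEq * P + F * hEP + hFP + hFq - F * hEq
  · linear_combination (norm := noncomm_ring)
      -q * hPF + q * hPF * E + q * hPE + hqE + hqF - hqF * E

/-- For idempotents `E`, `F` with `RE = Rq` and `FR = qR`, an idempotent `P` with `PR = ER`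
and `RP = RF` makes `1 - (1 - F) E` invertible. -/
theorem isUnit_one_sub_one_sub_mul {R : Type*} [Ring R] {E F P q : R}
    (hqE : q * E = q) (hEq : E * q = E) (hFq : F * q = q) (hqF : q * F = F)
    (hPE : P * E = E) (hEP : E * P = P) (hPF : P * F = P) (hFP : F * P = F) :
    IsUnit (1 - (1 - F) * E) := by
  refine isUnit_iff_exists.mpr ⟨P * q + 1 - q, ?_, ?_⟩
  · linear_combination (norm := noncomm_ring)
      -hEP * q + F * hEP * q + hFP * q + hFq + hEq - F * hEq
  · linear_combination (norm := noncomm_ring)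
      -P * hqE + P * hqF * E + hPF * E + hPE + hqE - hqF * E

/-- If `fBf = f` and `F = Bf`, `E = fB` satisfy `RE = Rq`, `FR = qR` for a projection `q`, then
dual core invertibility of `f` is governed by `F (1 - E)`, `(1 - F) E` and `(1 - F) F*`. -/
theorem exists_isDualCoreInverse_iff_of_inner_inverse {R : Type*} [Ring R] [StarRing R]
    {f B E F q : R} (hE : f * B = E) (hF : B * f = F) (hfBf : f * B * f = f)
    (hq : star q = q)
    (hqE : q * E = q) (hEq : E * q = E) (hFq : F * q = q) (hqF : q * F = F) :
    ((∃ x, IsDualCoreInverse f x) ↔ (IsUnit (1 - F * (1 - E)) ∧ IsUnit (1 - (1 - F) * E) ∧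
      IsUnit (1 - (1 - F) * star F))) ∧
    ((∃ x, IsDualCoreInverse f x) ↔ ((∃ v, (1 - F * (1 - E)) * v = 1) ∧
      (∃ w, w * (1 - (1 - F) * E) = 1) ∧ (∃ w, w * (1 - (1 - F) * star F) = 1))) := by
  have hEf : E * f = f := by rw [← hE, hfBf]
  have hfF : f * F = f := by rw [← hF, ← mul_assoc, hfBf]
  have hFF : F * F = F := by
    calc F * F = B * (f * F) := by rw [← mul_assoc, hF]
      _ = F := by rw [hfF, hF]
  have hEE : E * E = E := by
    calc E * E = (E * f) * B := by rw [mul_assoc, hE]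
      _ = E := by rw [hEf, hE]
  have units_of_exists : (∃ x, IsDualCoreInverse f x) → (IsUnit (1 - F * (1 - E)) ∧
      IsUnit (1 - (1 - F) * E) ∧ IsUnit (1 - (1 - F) * star F)) := by
    rintro ⟨x, h1, -, h3, h4, h5⟩
    have hPE : f * x * E = E := by rw [← hE, ← mul_assoc, h1]
    have hEP : E * (f * x) = f * x := by rw [← mul_assoc, hEf]
    have hxF : x * F = x := by
      calc x * F = x * x * (f * F) := by rw [← mul_assoc, h4]
        _ = x := by rw [hfF, h4]
    have hPF : f * x * F = f * x := by rw [mul_assoc, hxF]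
    have hFP : F * (f * x) = F := by
      calc F * (f * x) = B * (f * f * x) := by rw [← hF]; noncomm_ring
        _ = F := by rw [h5, hF]
    have hQF : x * f * F = x * f := by rw [mul_assoc, hfF]
    have hFQ : F * (x * f) = F := by
      calc F * (x * f) = B * (f * x * f) := by rw [← hF]; noncomm_ring
        _ = F := by rw [h1, hF]
    have hFsQ : star F * (x * f) = x * f := by
      simpa only [star_mul F (x * f), star_mul (x * f) F, h3] using congrArg star hQF
    have hQFs : x * f * star F = star F := by
      simpa only [star_mul F (x * f), star_mul (x * f) F, h3] using congrArg star hFQ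
    have hFsq : star F * q = star F := by
      simpa only [star_mul, hq] using congrArg star hqF
    have hqFs : q * star F = q := by
      simpa only [star_mul, hq] using congrArg star hFq
    refine ⟨isUnit_one_sub_mul_one_sub hqE hEq hFq hqF hPE hEP hPF hFP,
      isUnit_one_sub_one_sub_mul hqE hEq hFq hqF hPE hEP hPF hFP,
      isUnit_one_sub_one_sub_mul hqFs hFsq hFq hqF hQFs hFsQ hQF hFQ⟩
  have exists_of_inverses : ((∃ v, (1 - F * (1 - E)) * v = 1) ∧
      (∃ w, w * (1 - (1 - F) * E) = 1) ∧ (∃ w, w * (1 - (1 - F) * star F) = 1)) →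
      ∃ x, IsDualCoreInverse f x := by
    rintro ⟨⟨v, hv⟩, ⟨w, hw⟩, ⟨y, hy⟩⟩
    have hFsFs : star F * star F = star F := by rw [← star_mul, hFF]
    have hFv : F * E * v = F := by
      linear_combination (norm := noncomm_ring) F * hv + hFF * v - hFF * E * v
    have hwE : w * F * E = E := by
      linear_combination (norm := noncomm_ring) hw * E + w * hEE - w * F * hEE
    have hyF : y * F * star F = star F := by
      linear_combination (norm := noncomm_ring) hy * star F + y * hFsFs - y * F * hFsFs
    have hFy : F * star F * star y = F := by
      simpa [mul_assoc] using congrArg star hyF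
    refine ⟨_, isDualCoreInverse_of_factorizations (u := B * v) (w := w * B)
      (z := star B * star y) ?_ ?_ ?_⟩
    · calc f * f * (B * v) = f * (f * B) * v := by noncomm_ring
        _ = f * F * E * v := by rw [hE, hfF]
        _ = f * (F * E * v) := by noncomm_ring
        _ = f := by rw [hFv, hfF]
    · calc w * B * f * f = w * (B * f) * f := by noncomm_ring
        _ = w * F * (E * f) := by rw [hF, hEf]
        _ = w * F * E * f := by noncomm_ring
        _ = f := by rw [hwE, hEf]
    · calc f * star f * (star B * star y) = f * star (B * f) * star y := by
            rw [star_mul]; noncomm_ring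
        _ = f * F * star F * star y := by rw [hF, hfF]
        _ = f * (F * star F * star y) := by noncomm_ring
        _ = f := by rw [hFy, hfF]
  have inverses_of_units : (IsUnit (1 - F * (1 - E)) ∧ IsUnit (1 - (1 - F) * E) ∧
      IsUnit (1 - (1 - F) * star F)) → ((∃ v, (1 - F * (1 - E)) * v = 1) ∧
      (∃ w, w * (1 - (1 - F) * E) = 1) ∧ (∃ w, w * (1 - (1 - F) * star F) = 1)) :=
    fun ⟨h1, h2, h3⟩ => ⟨h1.exists_right_inv, h2.exists_left_inv, h3.exists_left_inv⟩
  exact ⟨⟨units_of_exists, fun h => exists_of_inverses (inverses_of_units h)⟩,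
    ⟨fun h => inverses_of_units (units_of_exists h), exists_of_inverses⟩⟩

/-- `f` is dual core invertible iff `1 - ρ`, `1 - ζ`, `1 - ξ` are
invertible, iff `1 - ρ` is right invertible and `1 - ζ`, `1 - ξ` are left invertible. -/
theorem sum_dual_core_invertible_iff {R : Type*} [Ring R] [StarRing R] (a aco e : R)
    (ha : IsDualCoreInverse a aco)
    (hu : IsUnit (1 + aco * e))
    (α β ε f ρ ζ ξ : R)
    (hα : α = Ring.inverse (1 + aco * e))
    (hβ : β = Ring.inverse (1 + e * aco))
    (hε : ε = (1 - a * aco) * e * α * (1 - aco * a))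
    (hf : f = a + e - ε)
    (hρ : ρ = α * (aco * a) * (1 + aco * e) * (1 - a * aco) * β)
    (hζ : ζ = α * (1 - aco * a) * (1 + e * aco) * (a * aco) * β)
    (hξ : ξ = α * (1 - aco * a) * star e * star aco * star α) :
    ((∃ x, IsDualCoreInverse f x) ↔ (IsUnit (1 - ρ) ∧ IsUnit (1 - ζ) ∧ IsUnit (1 - ξ))) ∧
    ((∃ x, IsDualCoreInverse f x) ↔
      ((∃ v, (1 - ρ) * v = 1) ∧ (∃ w, w * (1 - ζ) = 1) ∧ (∃ w, w * (1 - ξ) = 1))) := by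
  obtain ⟨h1, h2, hq, h4, h5⟩ := ha
  have hUα : (1 + aco * e) * α = 1 := by rw [hα, Ring.mul_inverse_cancel _ hu]
  have hαU : α * (1 + aco * e) = 1 := by rw [hα, Ring.inverse_mul_cancel _ hu]
  have hVr : (1 + e * aco) * (1 - e * α * aco) = 1 := by
    linear_combination (norm := noncomm_ring) -e * hUα * aco
  have hVl : (1 - e * α * aco) * (1 + e * aco) = 1 := by
    linear_combination (norm := noncomm_ring) -e * hαU * aco
  have hV : IsUnit (1 + e * aco) := isUnit_iff_exists.mpr ⟨_, hVr, hVl⟩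
  have hVβ : (1 + e * aco) * β = 1 := by rw [hβ, Ring.mul_inverse_cancel _ hV]
  have hβ' : β = 1 - e * α * aco := left_inv_eq_right_inv
    (by rw [hβ, Ring.inverse_mul_cancel _ hV]) hVr
  clear hα hβ
  have hqα : (1 - aco * a) * α = 1 - aco * a := by
    linear_combination (norm := noncomm_ring) (1 - aco * a) * hUα + h2 * e * α
  have hcβ : aco * β = α * aco := by
    rw [hβ']
    linear_combination (norm := noncomm_ring) -hUα * aco
  have hβp : β * (1 - a * aco) = 1 - a * aco := by
    rw [hβ']
    linear_combination (norm := noncomm_ring) e * α * h2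
  have hqc : (1 - aco * a) * aco = 0 := by
    linear_combination (norm := noncomm_ring) -h2
  have hE : f * (α * aco) = 1 - (1 - a * aco) * β := by
    have hεB : ε * (α * aco) = 0 := by
      rw [hε]
      linear_combination (norm := noncomm_ring)
        (1 - a * aco) * e * α * hqα * aco + (1 - a * aco) * e * α * hqc
    rw [hf, sub_mul, hεB, ← hcβ]
    linear_combination (norm := noncomm_ring) hVβ
  have hF : α * aco * f = 1 - α * (1 - aco * a) := by
    rw [hf, hε]
    linear_combination (norm := noncomm_ring) hαU + α * h2 * e * α * (1 - aco * a)
  have hfBf : f * (α * aco) * f = f := by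
    have hβf : (1 - a * aco) * β * f = 0 := by
      have hβε : β * ε = ε := by
        rw [hε]
        linear_combination (norm := noncomm_ring) hβp * e * α * (1 - aco * a)
      have hβe : β * e = e * α := by
        rw [hβ']
        linear_combination (norm := noncomm_ring) -e * hαU
      have hpp : (1 - a * aco) * (1 - a * aco) = 1 - a * aco := by
        linear_combination (norm := noncomm_ring) h1 * aco
      have h : (1 - a * aco) * β * f
          = (1 - a * aco) * β * a + (1 - a * aco) * (β * e) - (1 - a * aco) * (β * ε) := by
        rw [hf]; noncomm_ring
      rw [h, hβε, hβe, hε, hβ']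
      linear_combination (norm := noncomm_ring) -h1 - hpp * e * α * (1 - aco * a)
    rw [hE, sub_mul, hβf, one_mul, sub_zero]
  have hqE : aco * a * (1 - (1 - a * aco) * β) = aco * a := by
    linear_combination (norm := noncomm_ring) aco * h5 * β
  have hEq : (1 - (1 - a * aco) * β) * (aco * a) = 1 - (1 - a * aco) * β := by
    rw [hβ']
    linear_combination (norm := noncomm_ring) a * h4 + (1 - a * aco) * e * α * h4
  have hFq : (1 - α * (1 - aco * a)) * (aco * a) = aco * a := by
    linear_combination (norm := noncomm_ring) α * h2 * a
  have hqF : aco * a * (1 - α * (1 - aco * a)) = 1 - α * (1 - aco * a) := by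
    linear_combination (norm := noncomm_ring) hqα * (1 - aco * a) + h2 * a
  have hρ' : ρ = (1 - α * (1 - aco * a)) * (1 - (1 - (1 - a * aco) * β)) := by
    rw [hρ]
    linear_combination (norm := noncomm_ring)
      hαU * (1 - a * aco) * β + α * h2 * e * (1 - a * aco) * β
  have hζ' : ζ = (1 - (1 - α * (1 - aco * a))) * (1 - (1 - a * aco) * β) := by
    rw [hζ]
    linear_combination (norm := noncomm_ring)
      α * (1 - aco * a) * hVβ + α * (1 - aco * a) * e * h2 * β
  have hξ' : ξ = (1 - (1 - α * (1 - aco * a))) * star (1 - α * (1 - aco * a)) := by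
    have hs : star α * (1 + star e * star aco) = 1 := by
      simpa using congrArg star hUα
    have hs' : (1 + star e * star aco) * star α = 1 := by
      simpa using congrArg star hαU
    have hFs : star (1 - α * (1 - aco * a)) = 1 - (1 - aco * a) * star α := by
      rw [star_sub, star_mul, star_sub, star_one, hq]
    rw [hξ, hFs]
    linear_combination (norm := noncomm_ring)
      α * (1 - aco * a) * hs' + α * h2 * a * star α
  rw [hρ', hζ', hξ']
  exact exists_isDualCoreInverse_iff_of_inner_inverse hE hF hfBf hq hqE hEq hFq hqF
end

section
/- Let R be a unital ring with involution, a ∈ R dual core invertible with dual core inverse a_co, and e ∈ R such that 1 + a_co e is invertible. With α = (1 + a_co e)⁻¹, β = (1 + e a_co)⁻¹, ε = (1 − a a_co) e α (1 − a_co a), f = a + e − ε, ρ = α a_co a α⁻¹ (1 − a a_co) β, ζ = α(1 − a_co a) β⁻¹ a a_co β, and ξ = α(1 − a_co a) e* (a_co)* α*: if f is dual core invertible with dual core inverse f_co, then 1 − ρ and 1 − ξ are invertible, f_co = (1 − ξ)⁻¹ α a_co (1 − ρ)⁻¹, and moreover (1 − ρ)⁻¹ = 1 − a_co a + a_co a f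 f_co, (1 − ζ)⁻¹ = 1 − a_co a + f f_co a_co a, and (1 − ξ)⁻¹ = 1 − a_co a + f_co f a_co a. -/
theorem isUnit_and_inverse_eq {M : Type*} [MonoidWithZero M] {b c : M}
    (h : b * c = 1 ∧ c * b = 1) : IsUnit b ∧ Ring.inverse b = c :=
  ⟨⟨⟨b, c, h.1, h.2⟩, rfl⟩, Ring.inverse_unit ⟨b, c, h.1, h.2⟩⟩

theorem one_sub_mul_one_sub_inverse {R : Type*} [Ring R] {p p' q' Q : R}
    (hp'p : p' * p = p) (hpp' : p * p' = p') (hq'p : q' * p = q') (hpq' : p * q' = p)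
    (hp'Q : p' * Q = p') (hQp' : Q * p' = Q) (hq'Q : q' * Q = Q) (hQq' : Q * q' = q') :
    (1 - p' * (1 - q')) * (1 - p + p * Q) = 1 ∧
      (1 - p + p * Q) * (1 - p' * (1 - q')) = 1 := by
  constructor
  · linear_combination (norm := noncomm_ring)
      hp'p - hp'p * Q - p' * hq'p + p' * hq'p * Q + p' * hq'Q + hp'Q
  · linear_combination (norm := noncomm_ring)
      hpp' - hpp' * q' - p * hQp' + p * hQp' * q' + p * hQq' + hpq'

theorem one_sub_mul_one_sub_mul_inverse {R : Type*} [Ring R] {p q' Q u α : R}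
    (hp : p * p = p) (hαu : α * u = 1) (hpu : (1 - p) * u = 1 - p)
    (hpα : (1 - p) * α = 1 - p) (hp'p : α * p * u * p = p)
    (hq'p : q' * p = q') (hpq' : p * q' = p) (hp'Q : α * p * u * Q = α * p * u)
    (hQα : Q * α * (1 - p) = 0) (hq'Q : q' * Q = Q) (hQq' : Q * q' = q') :
    (1 - α * (1 - p) * q') * (1 - p + Q * p) = 1 ∧
      (1 - p + Q * p) * (1 - α * (1 - p) * q') = 1 := by
  constructor
  · linear_combination (norm := noncomm_ring)
      α * (1 - p) * hq'p - α * (1 - p) * hq'Q * p - hαu * Q * p + α * hpu * Q * p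
        + hp'Q * p + hp'p
  · linear_combination (norm := noncomm_ring)
      -(hpα * (1 - p) * q') + hpq' + hpq' - p * hpq' - hp - hQα * q' + Q * hpα * (1 - p) * q'
        + hQq' - Q * hpq' - Q * hpq' + Q * p * hpq' + Q * hp

theorem one_sub_mul_one_sub_mul_one_sub_inverse {R : Type*} [Ring R] {p P α A : R}
    (hp : p * p = p) (hpα : (1 - p) * α = 1 - p) (hA : A * (1 - p) = 1 - p)
    (hPα : P * α * (1 - p) = 0) (hPA : (1 - p) * A * P = 0)
    (hαP : α * (1 - p) * (1 - P) = 1 - P) (hAP : (1 - P) * (1 - p) * A = 1 - P) :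
    (1 - α * (1 - p) * (1 - A)) * (1 - p + P * p) = 1 ∧
      (1 - p + P * p) * (1 - α * (1 - p) * (1 - A)) = 1 := by
  constructor
  · linear_combination (norm := noncomm_ring)
      α * (1 - p) * hA + α * hPA * p + hαP * p + α * hp
  · linear_combination (norm := noncomm_ring)
      -(hpα * (1 - p) * (1 - A)) + P * hpα * (1 - p) * (1 - A) - hPα * (1 - A)
        - (1 - P) * hp * (1 - A) + hAP

theorem inverse_one_add_mul_comm {R : Type*} [Ring R] {b c : R} (h : IsUnit (1 + b * c)) :
    (1 + c * b) * Ring.inverse (1 + c * b) = 1 ∧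
      Ring.inverse (1 + c * b) * (1 + c * b) = 1 := by
  have h₁ := Ring.mul_inverse_cancel _ h
  have h₂ := Ring.inverse_mul_cancel _ h
  have hu : IsUnit (1 + c * b) :=
    (isUnit_and_inverse_eq (c := 1 - c * Ring.inverse (1 + b * c) * b)
      ⟨by linear_combination (norm := noncomm_ring) -(c * h₁ * b),
        by linear_combination (norm := noncomm_ring) -(c * h₂ * b)⟩).1
  exact ⟨Ring.mul_inverse_cancel _ hu, Ring.inverse_mul_cancel _ hu⟩


/-- if `f` is dual core invertible with dual core inverse `f_co`, then
`1 - ρ` and `1 - ξ` are invertible, `f_co = (1 - ξ)⁻¹ α a_co (1 - ρ)⁻¹`, and the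
stated formulas for `(1 - ρ)⁻¹`, `(1 - ζ)⁻¹`, `(1 - ξ)⁻¹` hold. -/
theorem sum_dual_core_inverse_formula {R : Type*} [Ring R] [StarRing R] (a aco e : R)
    (ha : IsDualCoreInverse a aco)
    (hu : IsUnit (1 + aco * e))
    (α β ε f ρ ζ ξ fco : R)
    (hα : α = Ring.inverse (1 + aco * e))
    (hβ : β = Ring.inverse (1 + e * aco))
    (hε : ε = (1 - a * aco) * e * α * (1 - aco * a))
    (hf : f = a + e - ε)
    (hρ : ρ = α * (aco * a) * (1 + aco * e) * (1 - a * aco) * β)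
    (hζ : ζ = α * (1 - aco * a) * (1 + e * aco) * (a * aco) * β)
    (hξ : ξ = α * (1 - aco * a) * star e * star aco * star α)
    (hfco : IsDualCoreInverse f fco) :
    IsUnit (1 - ρ) ∧ IsUnit (1 - ζ) ∧ IsUnit (1 - ξ) ∧
    fco = Ring.inverse (1 - ξ) * α * aco * Ring.inverse (1 - ρ) ∧
    Ring.inverse (1 - ρ) = 1 - aco * a + aco * a * (f * fco) ∧
    Ring.inverse (1 - ζ) = 1 - aco * a + f * fco * (aco * a) ∧
    Ring.inverse (1 - ξ) = 1 - aco * a + fco * f * (aco * a) := by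
  have huα := Ring.mul_inverse_cancel _ hu
  have hαu := Ring.inverse_mul_cancel _ hu
  obtain ⟨hvβ, hβv⟩ := inverse_one_add_mul_comm hu
  rw [← hα] at huα hαu
  rw [← hβ] at hvβ hβv
  clear hα hβ hu
  obtain ⟨hax, hxa, hps, hxxa, haax⟩ := ha
  obtain ⟨hfy, hyf, hPs, hyyf, hffy⟩ := hfco
  have hp : aco * a * (aco * a) = aco * a := by
    linear_combination (norm := noncomm_ring) hxa * a
  have hpq : aco * a * (a * aco) = aco * a := by
    linear_combination (norm := noncomm_ring) aco * haax
  have hqp : a * aco * (aco * a) = a * aco := by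
    linear_combination (norm := noncomm_ring) a * hxxa
  have hxp : aco * (aco * a) = aco := by rw [← mul_assoc, hxxa]
  have hap : a * (aco * a) = a := by rw [← mul_assoc, hax]
  have hxq : aco * (a * aco) = aco := by rw [← mul_assoc, hxa]
  have hpu : (1 - aco * a) * (1 + aco * e) = 1 - aco * a := by
    linear_combination (norm := noncomm_ring) -(hxa * e)
  have hpα : (1 - aco * a) * α = 1 - aco * a := by
    linear_combination (norm := noncomm_ring) (1 - aco * a) * huα - hpu * α
  have hxβ : α * aco = aco * β := by
    linear_combination (norm := noncomm_ring) hαu * aco * β - α * aco * hvβ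
  have hβp : β * (1 - aco * a) = 1 - aco * a := by
    linear_combination (norm := noncomm_ring) hβv * (1 - aco * a) + β * e * hxp
  have hpαx : aco * a * (α * aco) = α * aco := by
    linear_combination (norm := noncomm_ring) aco * a * hxβ + hxa * β - hxβ
  have hpαp : aco * a * (α * (aco * a)) = α * (aco * a) := by
    linear_combination (norm := noncomm_ring) hpαx * a
  obtain ⟨q', hq'⟩ : ∃ q', q' = 1 - (1 - a * aco) * β := ⟨_, rfl⟩
  have hq'f : f * (α * aco) = q' := by
    rw [hq', hf, hε]
    linear_combination (norm := noncomm_ring)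
      (a + e) * hxβ + hvβ + (1 - a * aco) * e * α * hpαx
  have hαxf : α * aco * f = α * (aco * a) * (1 + aco * e) := by
    rw [hf, hε]
    linear_combination (norm := noncomm_ring) α * hxq * e * α * (1 - aco * a) - α * hxa * e
  have hfp' : f * (α * (aco * a) * (1 + aco * e)) = f := by
    have h : f * α * (1 - aco * a) = 0 := by
      rw [hf, hε]
      linear_combination (norm := noncomm_ring)
        -((1 - a * aco) * e * α * hpα * (1 - aco * a)) - (1 - a * aco) * e * α * hp
          + a * huα * (1 - aco * a) - hap
    linear_combination (norm := noncomm_ring) f * hαu - h * (1 + aco * e)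
  have hp'p : α * (aco * a) * (1 + aco * e) * (aco * a) = aco * a := by
    linear_combination (norm := noncomm_ring) hαu * (aco * a) - α * hpu * (aco * a) + α * hp
  have hpp' : aco * a * (α * (aco * a) * (1 + aco * e)) = α * (aco * a) * (1 + aco * e) := by
    linear_combination (norm := noncomm_ring) hpαp * (1 + aco * e)
  have hq'p : q' * (aco * a) = q' := by
    rw [hq']
    linear_combination (norm := noncomm_ring) (1 - a * aco) * hβp + hqp
  have hpq' : aco * a * q' = aco * a := by
    rw [hq']
    linear_combination (norm := noncomm_ring) hpq * β
  have hp'Q : α * (aco * a) * (1 + aco * e) * (f * fco) = α * (aco * a) * (1 + aco * e) := by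
    rw [← hαxf]
    linear_combination (norm := noncomm_ring) α * aco * hffy
  have hp'P : α * (aco * a) * (1 + aco * e) * (fco * f) = α * (aco * a) * (1 + aco * e) := by
    rw [← hαxf]
    linear_combination (norm := noncomm_ring) α * aco * hfy
  have hPp' : fco * f * (α * (aco * a) * (1 + aco * e)) = fco * f := by
    rw [mul_assoc, hfp']
  have hQp' : f * fco * (α * (aco * a) * (1 + aco * e)) = f * fco := by
    linear_combination (norm := noncomm_ring)
      f * fco * hPp' + f * hyyf - f * hyyf * (α * (aco * a) * (1 + aco * e))
  have hq'Q : q' * (f * fco) = f * fco := by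
    rw [← hq'f]
    linear_combination (norm := noncomm_ring) f * hαxf * fco + hfp' * fco
  have hQq' : f * fco * q' = q' := by
    rw [← hq'f]
    linear_combination (norm := noncomm_ring) hfy * (α * aco)
  have hp'α : α * (aco * a) * (1 + aco * e) * α * (1 - aco * a) = 0 := by
    linear_combination (norm := noncomm_ring)
      α * (aco * a) * huα * (1 - aco * a) - α * hp
  have hQα : f * fco * α * (1 - aco * a) = 0 := by
    linear_combination (norm := noncomm_ring) f * fco * hp'α - hQp' * α * (1 - aco * a)
  have hPα : fco * f * α * (1 - aco * a) = 0 := by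
    linear_combination (norm := noncomm_ring) fco * f * hp'α - hPp' * α * (1 - aco * a)
  have hαP : α * (1 - aco * a) * (1 - fco * f) = 1 - fco * f := by
    linear_combination (norm := noncomm_ring)
      hαu * (1 - fco * f) - α * hpu * (1 - fco * f) + hp'P
  have hA : star α * (1 - aco * a) = 1 - aco * a := by
    simpa only [star_mul, star_sub, star_one, ← star_mul aco a, hps] using congrArg star hpα
  have hPA : (1 - aco * a) * star α * (fco * f) = 0 := by
    have h := congrArg star hPα
    rwa [star_mul, star_mul, star_sub, star_one, hps, hPs, star_zero, ← mul_assoc] at h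
  have hAP : (1 - fco * f) * (1 - aco * a) * star α = 1 - fco * f := by
    have h := congrArg star hαP
    rwa [star_mul, star_mul, star_sub, star_sub, star_one, hps, hPs, ← mul_assoc] at h
  have hξA : star e * star aco * star α = 1 - star α := by
    have h := congrArg star hαu
    rw [star_mul, star_add, star_mul, star_one] at h
    linear_combination (norm := noncomm_ring) h
  have hρ' : ρ = α * (aco * a) * (1 + aco * e) * (1 - q') := by
    rw [hρ, hq']
    noncomm_ring
  have hζ' : ζ = α * (1 - aco * a) * q' := by
    rw [hζ, hq']
    linear_combination (norm := noncomm_ring)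
      α * (1 - aco * a) * hvβ + α * (1 - aco * a) * e * hxq * β
  have hξ' : ξ = α * (1 - aco * a) * (1 - star α) := by
    rw [hξ, ← hξA]
    noncomm_ring
  obtain ⟨hρu, hρi⟩ := isUnit_and_inverse_eq
    (one_sub_mul_one_sub_inverse hp'p hpp' hq'p hpq' hp'Q hQp' hq'Q hQq')
  obtain ⟨hζu, hζi⟩ := isUnit_and_inverse_eq
    (one_sub_mul_one_sub_mul_inverse hp hαu hpu hpα hp'p hq'p hpq' hp'Q hQα hq'Q hQq')
  obtain ⟨hξu, hξi⟩ := isUnit_and_inverse_eq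
    (one_sub_mul_one_sub_mul_one_sub_inverse hp hpα hA hPα hPA hαP hAP)
  rw [hρ', hζ', hξ', hρi, hζi, hξi]
  refine ⟨hρu, hζu, hξu, ?_, rfl, rfl, rfl⟩
  have hP : fco * f * (α * aco) * (f * fco) = fco := by
    linear_combination (norm := noncomm_ring) fco * f * hαxf * fco + hPp' * fco + hyf
  have hN : (1 - aco * a + fco * f * (aco * a)) * (α * aco) = fco * f * (α * aco) := by
    linear_combination (norm := noncomm_ring) fco * f * hpαx - hpαx
  have hM : α * aco * (1 - aco * a + aco * a * (f * fco)) = α * aco * (f * fco) := by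
    linear_combination (norm := noncomm_ring) α * hxp * (f * fco) - α * hxp
  rw [mul_assoc _ α aco, hN, mul_assoc, hM, ← mul_assoc, hP]
end

section
/- Let R be a unital ring with involution, J(R) its Jacobson radical, a ∈ R core invertible with core inverse a^co, and j ∈ J(R) (so that 1 + a^co j is invertible). Then a + j is core invertible if and only if (1 − a a^co) j (1 + a^co j)⁻¹ (1 − a^co a) = 0. -/
/-- `1 + k` is a unit for `k` in the Jacobson radical of a (noncommutative) ring. -/
theorem isUnit_one_add_of_mem_jacobson_bot {R : Type*} [Ring R] {k : R}
    (hk : k ∈ Ideal.jacobson (⊥ : Ideal R)) : IsUnit (1 + k) := by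
  have key : ∀ l ∈ Ideal.jacobson (⊥ : Ideal R), ∃ z, z * (1 + l) = 1 := by
    intro l hl
    obtain ⟨z, hz⟩ := Ideal.mem_jacobson_iff.1 hl 1
    refine ⟨z, ?_⟩
    rw [Ideal.mem_bot] at hz
    rw [mul_one, sub_eq_zero] at hz
    rw [mul_add, mul_one, add_comm, hz]
  obtain ⟨z, hz⟩ := key k hk
  obtain ⟨c, hc⟩ := key (-(z * k)) (neg_mem (Ideal.mul_mem_left _ z hk))
  have hz' : 1 + -(z * k) = z := by
    rw [mul_add, mul_one] at hz
    rw [← sub_eq_add_neg, sub_eq_iff_eq_add, hz]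
  rw [hz'] at hc
  have hck : c = 1 + k := left_inv_eq_right_inv hc hz
  exact ⟨⟨1 + k, z, hck ▸ hc, hz⟩, rfl⟩

/-- A characterization of the Jacobson radical that is manifestly left-right symmetric. -/
theorem mem_jacobson_bot_iff_forall_isUnit {R : Type*} [Ring R] {k : R} :
    k ∈ Ideal.jacobson (⊥ : Ideal R) ↔ ∀ r s : R, IsUnit (1 + r * k * s) := by
  refine ⟨fun hk r s ↦ isUnit_one_add_of_mem_jacobson_bot
    (Ideal.mul_mem_right s _ (Ideal.mul_mem_left _ r hk)), fun h ↦ ?_⟩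
  refine Ideal.mem_jacobson_iff.2 fun y ↦ ?_
  obtain ⟨u, hu⟩ := h y 1
  refine ⟨↑u⁻¹, ?_⟩
  have h1 := u.inv_mul
  rw [hu, mul_one, mul_add, mul_one, ← mul_assoc] at h1
  rw [Ideal.mem_bot, ← h1]
  abel

theorem star_mem_jacobson_bot {R : Type*} [Ring R] [StarRing R] {k : R}
    (hk : k ∈ Ideal.jacobson (⊥ : Ideal R)) : star k ∈ Ideal.jacobson (⊥ : Ideal R) := by
  rw [mem_jacobson_bot_iff_forall_isUnit] at hk ⊢
  intro r s
  simpa [mul_assoc] using (hk (star s) (star r)).star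

/-- Units lift modulo the Jacobson radical. -/
theorem IsUnit.of_sub_mem_jacobson_bot {R : Type*} [Ring R] {s t : R} (ht : IsUnit t)
    (hst : s - t ∈ Ideal.jacobson (⊥ : Ideal R)) : IsUnit s := by
  obtain ⟨u, rfl⟩ := ht
  have h := u.isUnit.mul (isUnit_one_add_of_mem_jacobson_bot (Ideal.mul_mem_left _ (↑u⁻¹ : R) hst))
  rwa [mul_add, mul_one, Units.mul_inv_cancel_left, add_sub_cancel] at h

theorem IsIdempotentElem.eq_zero_of_mem_jacobson_bot {R : Type*} [Ring R] {h : R}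
    (hh : IsIdempotentElem h) (hJ : h ∈ Ideal.jacobson (⊥ : Ideal R)) : h = 0 := by
  have hu := isUnit_one_add_of_mem_jacobson_bot (neg_mem hJ)
  refine hu.mul_right_eq_zero.1 ?_
  rw [add_mul, one_mul, neg_mul, hh.eq, add_neg_cancel]

/-- If `e + e* - 1` is a unit, then the right ideal of the idempotent `e` is generated by a
projection. -/
theorem exists_projection_of_isUnit {R : Type*} [Ring R] [StarRing R] {e : R}
    (he : e * e = e) (hu : IsUnit (e + star e - 1)) :
    ∃ f, star f = f ∧ e * f = f ∧ f * e = e := by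
  obtain ⟨t, ht⟩ := hu
  have he' : star e * star e = star e := by rw [← star_mul, he]
  have hst : star t = t := by
    ext
    simp [ht, add_comm]
  have hst' : star (↑t⁻¹ : R) = ↑t⁻¹ := by
    rw [← Units.coe_star, star_inv, hst]
  have hc : (↑t⁻¹ : R) * star e = e * ↑t⁻¹ := by
    rw [Units.inv_mul_eq_iff_eq_mul, ← mul_assoc, Units.eq_mul_inv_iff_mul_eq, ht]
    simp only [mul_add, add_mul, mul_sub, sub_mul, he, he', mul_one, one_mul]
    abel
  refine ⟨e * ↑t⁻¹, by rw [star_mul, hst', hc], by rw [← mul_assoc, he], ?_⟩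
  rw [← hc, mul_assoc, Units.inv_mul_eq_iff_eq_mul, ht]
  simp only [add_mul, sub_mul, he, one_mul]
  abel

/-- Core invertibility from a projection `f` generating the same right ideal as the idempotent `e`,
where `e b = b`, when `b e + 1 - e` is a unit. -/
theorem exists_isCoreInverse_of_isUnit {R : Type*} [Ring R] [StarRing R] {b e f : R}
    (he : e * e = e) (heb : e * b = b) (hf : star f = f) (hef : e * f = f)
    (hfe : f * e = e) (hu : IsUnit (b * e + 1 - e)) : ∃ x, IsCoreInverse b x := by
  obtain ⟨w, hw⟩ := hu
  have hwe : (w : R) * e = b * e := by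
    rw [hw]; simp only [add_mul, sub_mul, mul_assoc, he, one_mul]; abel
  have hew : e * (w : R) = b * e := by
    rw [hw, mul_sub, mul_add, ← mul_assoc, heb, he, mul_one]; abel
  have hc : (↑w⁻¹ : R) * e = e * ↑w⁻¹ := by
    rw [Units.inv_mul_eq_iff_eq_mul, ← mul_assoc, Units.eq_mul_inv_iff_mul_eq, hew, hwe]
  have hwb : (↑w⁻¹ : R) * (b * b) = b := by
    rw [Units.inv_mul_eq_iff_eq_mul, hw, sub_mul, add_mul, mul_assoc, heb, one_mul]; abel
  have hfb : f * b = b := by rw [← heb, ← mul_assoc, hfe]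
  have hff : f * f = f := by
    nth_rw 2 [← hef]; rw [← mul_assoc, hfe, hef]
  have hbz : b * (↑w⁻¹ * f) = f := by
    rw [← hef, ← mul_assoc (↑w⁻¹ : R), hc, ← mul_assoc, ← mul_assoc, ← hwe, mul_assoc (w : R), ← hc,
      Units.mul_inv_cancel_left]
  refine ⟨↑w⁻¹ * f, ?_, ?_, ?_, ?_, ?_⟩
  · rw [hbz, hfb]
  · rw [mul_assoc, hbz, mul_assoc, hff]
  · rw [hbz, hf]
  · have hez : e * (↑w⁻¹ * f) = ↑w⁻¹ * f := by rw [← mul_assoc, ← hc, mul_assoc, hef]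
    rw [← mul_assoc, hbz, ← hez, ← mul_assoc, hfe]
  · rw [mul_assoc, ← mul_assoc f, hfb, hwb]

/-- An idempotent `e` congruent modulo the Jacobson radical to some `f` with `f e = e` and `f f = f`
generates the same right ideal as `f`. -/
theorem mul_eq_right_of_sub_mem_jacobson_bot {R : Type*} [Ring R] {e f : R}
    (he : e * e = e) (hf : f * f = f) (hfe : f * e = e)
    (h : f - e ∈ Ideal.jacobson (⊥ : Ideal R)) : e * f = f := by
  have hJ : f - e * f ∈ Ideal.jacobson (⊥ : Ideal R) := by
    simpa only [sub_mul, hf] using Ideal.mul_mem_right f _ h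
  have hi : IsIdempotentElem (f - e * f) := by
    have h1 : f * (e * f) = e * f := by rw [← mul_assoc, hfe]
    have h2 : e * f * (e * f) = e * f := by rw [mul_assoc, h1, ← mul_assoc, he]
    rw [IsIdempotentElem, sub_mul, mul_sub, mul_sub, h1, h2, hf, mul_assoc, hf]; abel
  exact (sub_eq_zero.1 (hi.eq_zero_of_mem_jacobson_bot hJ)).symm

/-- for `a` core invertible and `j` in the Jacobson radical,
`a + j` is core invertible iff `(1 - a a^co) j (1 + a^co j)⁻¹ (1 - a^co a) = 0`. -/
theorem radical_perturbation_core_invertible_iff {R : Type*} [Ring R] [StarRing R]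
    (a aco j : R)
    (ha : IsCoreInverse a aco)
    (hj : j ∈ Ideal.jacobson (⊥ : Ideal R)) :
    (∃ x, IsCoreInverse (a + j) x) ↔
      (1 - a * aco) * j * Ring.inverse (1 + aco * j) * (1 - aco * a) = 0 := by
  obtain ⟨h1, h2, h3, h4, h5⟩ := ha
  set J := Ideal.jacobson (⊥ : Ideal R)
  obtain ⟨u, hu⟩ := isUnit_one_add_of_mem_jacobson_bot (Ideal.mul_mem_left _ aco hj)
  rw [← hu, Ring.inverse_unit]
  set v : R := ↑u⁻¹
  have huv : (1 + aco * j) * v = 1 := by rw [← hu]; exact u.mul_inv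
  have hvu : v * (1 + aco * j) = 1 := by rw [← hu]; exact u.inv_mul
  set y := v * aco with hy
  have hyx : y - aco = -(aco * j * y) := by
    have : (1 + aco * j) * y = aco := by rw [hy, ← mul_assoc, huv, one_mul]
    rw [add_mul, one_mul] at this
    rw [sub_eq_iff_eq_add, neg_add_eq_sub, eq_sub_iff_add_eq, this]
  have hyb : y * (a + j) = 1 - v * (1 - aco * a) := by
    have : y * (a + j) = v * (1 + aco * j) - v * (1 - aco * a) := by rw [hy]; noncomm_ring
    rw [this, hvu]
  have hbyb : (a + j) * y * (a + j) - (a + j) =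
      -((1 - a * aco) * j * v * (1 - aco * a)) := by
    have hsplit : (a + j) = a * (1 + aco * j) + (1 - a * aco) * j := by noncomm_ring
    have haq : a * (1 - aco * a) = 0 := by rw [mul_sub, mul_one, ← mul_assoc, h1, sub_self]
    calc (a + j) * y * (a + j) - (a + j) = -((a + j) * (v * (1 - aco * a))) := by
          rw [mul_assoc, hyb]; noncomm_ring
      _ = -(a * ((1 + aco * j) * v) * (1 - aco * a) +
            (1 - a * aco) * j * v * (1 - aco * a)) := by
          nth_rw 1 [hsplit]; noncomm_ring
      _ = _ := by rw [huv, mul_one, haq, zero_add]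
  have hqx : (1 - aco * a) * aco = 0 := by rw [sub_mul, one_mul, h2, sub_self]
  have hyby : y * (a + j) * y = y := by
    have hqy : (1 - aco * a) * y = 0 := by
      rw [eq_add_of_sub_eq hyx, mul_add, mul_neg, mul_assoc aco, ← mul_assoc, hqx, zero_mul,
        neg_zero, zero_add]
    rw [hyb, sub_mul, one_mul, mul_assoc, hqy, mul_zero, sub_zero]
  have hee : (a + j) * y * ((a + j) * y) = (a + j) * y := by
    rw [mul_assoc, ← mul_assoc y, hyby]
  have hep : (a + j) * y - a * aco ∈ J := by
    have : (a + j) * y - a * aco = a * (y - aco) + j * y := by noncomm_ring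
    rw [this, hyx]
    exact add_mem (Ideal.mul_mem_left _ _ (neg_mem (Ideal.mul_mem_right _ _
      (Ideal.mul_mem_left _ _ hj)))) (Ideal.mul_mem_right _ _ hj)
  have hpp : a * aco * (a * aco) = a * aco := by rw [← mul_assoc, h1]
  constructor
  · rintro ⟨z, z1, -, z3, -, -⟩
    set f := (a + j) * z with hf
    have hff : f * f = f := by
      nth_rw 2 [hf]; rw [← mul_assoc, z1]
    have hfp : a * aco - f * (a * aco) ∈ J := by
      have : a * aco - f * (a * aco) =
          ((a + j) - f * (a + j)) * aco - j * aco + f * j * aco := by noncomm_ring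
      rw [this, z1, sub_self, zero_mul, zero_sub]
      exact add_mem (neg_mem (Ideal.mul_mem_right _ _ hj))
        (Ideal.mul_mem_right _ _ (Ideal.mul_mem_left _ _ hj))
    have hpf : a * aco * f - f ∈ J := by
      have : a * aco * f - f = (a * aco * a - a) * z + a * aco * j * z - j * z := by
        rw [hf]; noncomm_ring
      rw [this, h1, sub_self, zero_mul, zero_add]
      exact sub_mem (Ideal.mul_mem_right _ _ (Ideal.mul_mem_left _ _ hj))
        (Ideal.mul_mem_right _ _ hj)
    have hsfp := star_mem_jacobson_bot hfp
    rw [star_sub, star_mul f, h3, z3] at hsfp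
    have hfe : f - (a + j) * y ∈ J := by
      have := neg_mem (add_mem (add_mem hsfp hpf) hep)
      convert this using 1
      abel
    have hef := mul_eq_right_of_sub_mem_jacobson_bot hee hff
      (by rw [← mul_assoc, z1]) hfe
    have hb : (a + j) * y * (a + j) = a + j := by
      nth_rw 2 [← z1]
      rw [← mul_assoc, hef, z1]
    rwa [hb, sub_self, eq_comm, neg_eq_zero] at hbyb
  · intro hcond
    rw [hcond, neg_zero, sub_eq_zero] at hbyb
    have hpx : a * aco * aco = aco := by rw [mul_assoc, h4]
    have hxp : aco * (a * aco) = aco := by rw [← mul_assoc, h2]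
    have hxap : aco * a * (a * aco) = a * aco := by
      rw [← mul_assoc, mul_assoc aco, h5]
    set e := (a + j) * y
    set p := a * aco
    have hse := star_mem_jacobson_bot hep
    rw [star_sub, h3] at hse
    have hproj : IsUnit (e + star e - 1) := by
      have hs : (p + p - 1) * (p + p - 1) = 1 := by
        simp only [mul_add, add_mul, mul_sub, sub_mul, hpp, mul_one, one_mul]; abel
      refine IsUnit.of_sub_mem_jacobson_bot ⟨⟨p + p - 1, p + p - 1, hs, hs⟩, rfl⟩ ?_
      convert add_mem hep hse using 1
      simp only
      abel
    obtain ⟨f, hf, hef, hfe⟩ := exists_projection_of_isUnit hee hproj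
    refine exists_isCoreInverse_of_isUnit hee hbyb hf hef hfe ?_
    have i1 : (a * p + 1 - p) * (aco + 1 - p) = 1 := by
      have : (a * p + 1 - p) * (aco + 1 - p) =
        a * (p * aco) + (a * p - a * (p * p)) + (aco - p * aco) + 1 - p - (p - p * p) := by
          noncomm_ring
      rw [this, hpx, hpp]; simp [p]
    have i2 : (aco + 1 - p) * (a * p + 1 - p) = 1 := by
      have hpa : p * a = a := h1
      have : (aco + 1 - p) * (a * p + 1 - p) =
        aco * a * p + (aco - aco * p) + (a - p * a) * p + 1 - p - (p - p * p) := by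
          noncomm_ring
      rw [this, hpa, hpp, hxp, hxap]; simp
    refine IsUnit.of_sub_mem_jacobson_bot ⟨⟨_, _, i1, i2⟩, rfl⟩ ?_
    have : (a + j) * e + 1 - e - (a * p + 1 - p) = (a - 1) * (e - p) + j * e := by noncomm_ring
    simp only [this]
    exact add_mem (Ideal.mul_mem_left _ _ hep) (Ideal.mul_mem_right _ _ hj)
end
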